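/- Let n ≥ 2 and let h be a Hessenberg function for type D_n. For each Hessenberg function h' for type D_n with h'(i) ≤ h(i) for all i, let P_{h'} denote the class of ∏_{i=1}^{n} ∏_{j=h'(i)+1}^{h(i)} α_{i,j} in R^{D}_{h}, where α_{i,j} are the type D root labels (this class equals, up to a nonzero scalar, the Poincaré dual [Hess(N,h')] of the smaller regular nilpotent Hessenberg variety inside Hess(N,h)). Then the family {P_{h'} : h' a Hessenberg function with h' ≤ h pointwise} is linearly independent over ℝ in R^{D}_{h}. -/

import Mathlib

open MvPolynomial

noncomputable section

/-- The variable `x_k` (1-indexed) of `ℝ[x_1,…,x_n]`. -/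
def xv (n : ℕ) (k : ℕ) : MvPolynomial (Fin n) ℝ :=
  if h : 1 ≤ k ∧ k ≤ n then X ⟨k - 1, by omega⟩ else 0

/-- The type `D_n` root label `α_{i,j}`:
for `i ≤ n−1`, `x_i − x_j` if `i+1 ≤ j ≤ n` and `x_i + x_{2n−j}` if `n+1 ≤ j ≤ 2n−i−1`;
and `α_{n,j} = x_{2n−j} + x_n` for `n+1 ≤ j ≤ 2n−1`. -/
def alD (n i j : ℕ) : MvPolynomial (Fin n) ℝ :=
  if i = n then xv n (2 * n - j) + xv n n
  else if j ≤ n then xv n i - xv n j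
  else xv n i + xv n (2 * n - j)

/-- The type `D_n` polynomials `f^{D}_{i,j}` (with `f^{D}_{n,2n−1−r}` encoded at `i = n`,
`j = 2n−1−r`). -/
def fDij (n i j : ℕ) : MvPolynomial (Fin n) ℝ :=
  if i = n then
    (∑ k ∈ Finset.Icc 1 (2 * n - 1 - j),
        ((-1 : ℝ) ^ (n - (2 * n - 1 - j) + 1)) •
          ∏ ℓ ∈ Finset.Icc (2 * n - 1 - j + 1) n, (xv n k - xv n ℓ)) +
      (n : ℝ) • ∏ ℓ ∈ Finset.Icc (2 * n - 1 - j + 1) n, xv n ℓ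
  else if j ≤ n - 2 then
    ∑ k ∈ Finset.Icc 1 i, (∏ ℓ ∈ Finset.Icc (i + 1) j, (xv n k - xv n ℓ)) * xv n k
  else if j = n - 1 then
    (∑ k ∈ Finset.Icc 1 i,
        (∏ ℓ ∈ Finset.Icc (i + 1) (n - 1), (xv n k - xv n ℓ)) * (xv n k + xv n n)) +
      ((-1 : ℝ) ^ (n - i) * (n : ℝ)) • ∏ ℓ ∈ Finset.Icc (i + 1) n, xv n ℓ
  else
    (∑ k ∈ Finset.Icc 1 i,
        (∏ ℓ ∈ Finset.Icc (i + 1) n, (xv n k - xv n ℓ)) *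
          ∏ t ∈ Finset.Icc (n - (j - n)) n, (xv n k + xv n t)) +
      ((-1 : ℝ) ^ (n - i + 1) * (n : ℝ)) •
        ((∏ ℓ ∈ Finset.Icc (i + 1) (n - 1 - (j - n)), xv n ℓ) *
          ∏ t ∈ Finset.Icc (n - (j - n)) n, xv n t ^ 2)

/-- The ideal `(f^{D}_{1,h(1)}, …, f^{D}_{n,h(n)})`,
so that `R^{D}_h = ℝ[x_1,…,x_n]/IDh n h ≅ H^*(Hess(N,h);ℝ)` in type `D_n`. -/
def IDh (n : ℕ) (h : ℕ → ℕ) : Ideal (MvPolynomial (Fin n) ℝ) :=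
  Ideal.span ((fun i => fDij n i (h i)) '' Set.Icc 1 n)

/-- Hessenberg functions `h'` of type `D_n` with `h' ≤ h` pointwise (normalised by
`h' i = 0` outside `{1,…,n}`): the index set of the Poincaré duals `[Hess(N,h')]`. -/
def HessSubD (n : ℕ) (h : ℕ → ℕ) : Type :=
  {h' : ℕ → ℕ //
    (∀ i ∈ Finset.Icc 1 (n - 1), i ≤ h' i ∧ h' i ≤ 2 * n - 1 - i) ∧
    (n ≤ h' n ∧ h' n ≤ 2 * n - 1) ∧
    (∀ i ∈ Finset.Icc 1 (n - 2), h' i ≠ 2 * n - 1 - i → h' i ≤ h' (i + 1)) ∧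
    (∀ i ∈ Finset.Icc 1 (n - 2), h' i = 2 * n - 1 - i → h' (i + 1) = 2 * n - 1 - (i + 1)) ∧
    (∀ i ∈ Finset.Icc 1 (n - 2), n + 1 ≤ h' i → 2 * n - i ≤ h' n) ∧
    (∀ i ∈ Finset.Icc 1 (n - 2), 2 * n - i ≤ h' n → n - 1 ≤ h' i) ∧
    (∀ i, i ∉ Finset.Icc 1 n → h' i = 0) ∧
    (∀ i ∈ Finset.Icc 1 n, h' i ≤ h i)}

section Spanning

variable {R : Type*} [CommRing R]

/-- The colon ideal `(𝔞 : γ)`. -/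
def colonBy (𝔞 : Ideal R) (γ : R) : Ideal R :=
  Submodule.comap (LinearMap.mulLeft R γ) 𝔞

lemma mem_colonBy {𝔞 : Ideal R} {γ r : R} : r ∈ colonBy 𝔞 γ ↔ γ * r ∈ 𝔞 := Iff.rfl

lemma le_colonBy (𝔞 : Ideal R) (γ : R) : 𝔞 ≤ colonBy 𝔞 γ :=
  fun _ hr => 𝔞.mul_mem_left γ hr

lemma colonBy_colonBy (𝔞 : Ideal R) (π γ : R) :
    colonBy (colonBy 𝔞 π) γ = colonBy 𝔞 (π * γ) := by
  ext r
  simp only [mem_colonBy, mul_assoc]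

lemma natDegree_prod_X_sub_C_le (S : Finset ℕ) (y : ℕ → R) :
    (∏ l ∈ S, (Polynomial.X - Polynomial.C (y l))).natDegree ≤ S.card := by
  refine (Polynomial.natDegree_prod_le _ _).trans ?_
  refine (Finset.sum_le_card_nsmul _ _ 1 fun l _ => Polynomial.natDegree_X_sub_C_le _).trans ?_
  simp

lemma mem_sup_span_self (𝔞 : Ideal R) (γ : R) : γ ∈ 𝔞 ⊔ Ideal.span {γ} :=
  Ideal.mem_sup_right (Ideal.mem_span_singleton_self γ)

variable [Algebra ℝ R]

/-- Modulo `𝔞`, the ring `R` is spanned over `ℝ` by at most `N` elements of `M`, among which are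
all elements of `F`. -/
def SpansMod (M : Submonoid R) (𝔞 : Ideal R) (N : ℕ) (F : Set R) : Prop :=
  ∃ B : Finset R, F ⊆ B ∧ (B : Set R) ⊆ M ∧ B.card ≤ N ∧
    ∀ r, ∃ b ∈ Submodule.span ℝ (B : Set R), r - b ∈ 𝔞

variable {M : Submonoid R}

lemma SpansMod.mono {𝔞 𝔟 : Ideal R} {N N' : ℕ} {F F' : Set R} (H : SpansMod M 𝔞 N F)
    (h𝔞 : 𝔞 ≤ 𝔟) (hN : N ≤ N') (hF : F' ⊆ F) : SpansMod M 𝔟 N' F' := by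
  obtain ⟨B, hFB, hBM, hB, hsp⟩ := H
  refine ⟨B, hF.trans hFB, hBM, hB.trans hN, fun r => ?_⟩
  obtain ⟨b, hb, hr⟩ := hsp r
  exact ⟨b, hb, h𝔞 hr⟩

lemma spansMod_of_one_mem {𝔞 : Ideal R} (h : (1 : R) ∈ 𝔞) : SpansMod M 𝔞 0 ∅ :=
  ⟨∅, by simp, by simp, by simp, fun r => ⟨0, zero_mem _, by
    simpa using 𝔞.mul_mem_left r h⟩⟩

/-- Splitting off one factor `γ`: a spanning set modulo `𝔞 + (γ)` together with `γ` times a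
spanning set modulo `(𝔞 : γ)` spans modulo `𝔞`. -/
lemma SpansMod.strip {𝔞 : Ideal R} {γ : R} (hγ : γ ∈ M) {N₁ N₂ : ℕ} {F₁ F₂ F : Set R}
    (H₁ : SpansMod M (𝔞 ⊔ Ideal.span {γ}) N₁ F₁) (H₂ : SpansMod M (colonBy 𝔞 γ) N₂ F₂)
    (hF : ∀ f ∈ F, f ∈ F₁ ∨ ∃ g ∈ F₂, f = γ * g) : SpansMod M 𝔞 (N₁ + N₂) F := by
  classical
  obtain ⟨B₁, hF₁, hM₁, hc₁, hs₁⟩ := H₁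
  obtain ⟨B₂, hF₂, hM₂, hc₂, hs₂⟩ := H₂
  refine ⟨B₁ ∪ B₂.image (γ * ·), ?_, ?_, ?_, ?_⟩
  · intro f hf
    rcases hF f hf with h | ⟨g, hg, rfl⟩
    · simp [show f ∈ B₁ from hF₁ h]
    · have : g ∈ B₂ := hF₂ hg
      simp only [Finset.coe_union, Finset.coe_image]
      exact Or.inr ⟨g, this, rfl⟩
  · intro f hf
    simp only [Finset.coe_union, Finset.coe_image] at hf
    rcases hf with h | ⟨g, hg, rfl⟩
    · exact hM₁ h
    · exact M.mul_mem hγ (hM₂ hg)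
  · exact (Finset.card_union_le _ _).trans
      (add_le_add hc₁ (Finset.card_image_le.trans hc₂))
  · intro r
    obtain ⟨b₁, hb₁, h₁⟩ := hs₁ r
    obtain ⟨a, ha, c, hc, hac⟩ := Submodule.mem_sup.1 h₁
    obtain ⟨q, rfl⟩ := Ideal.mem_span_singleton'.1 hc
    obtain ⟨b₂, hb₂, h₂⟩ := hs₂ q
    refine ⟨b₁ + γ * b₂, ?_, ?_⟩
    · refine add_mem (Submodule.span_mono (by simp) hb₁) ?_
      have := Submodule.mem_map_of_mem (f := LinearMap.mulLeft ℝ γ) hb₂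
      rw [Submodule.map_span] at this
      refine Submodule.span_mono ?_ this
      rw [Finset.coe_union, Finset.coe_image]
      exact Set.subset_union_right
    · rw [mem_colonBy] at h₂
      have : r - (b₁ + γ * b₂) = a + γ * (q - b₂) := by
        linear_combination -hac
      rw [this]
      exact add_mem ha h₂

/-- Splitting off the factors `γ u`, `u ∈ S`, one after the other in increasing order. -/
lemma SpansMod.chain {ι : Type*} [LinearOrder ι] (S : Finset ι) (γ : ι → R)
    (hγ : ∀ u, γ u ∈ M) {𝔞 : Ideal R} {N N' : ℕ} {F F' : Set R}
    (H : ∀ u ∈ S, SpansMod M (𝔞 ⊔ Ideal.span {γ u}) N F)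
    (H' : SpansMod M (colonBy 𝔞 (∏ u ∈ S, γ u)) N' F') :
    SpansMod M 𝔞 (S.card * N + N')
      {f | (∃ u ∈ S, ∃ g ∈ F, f = (∏ v ∈ S with v < u, γ v) * g) ∨
        ∃ g ∈ F', f = (∏ u ∈ S, γ u) * g} := by
  classical
  induction S using Finset.induction_on_max generalizing N' F' with
  | empty =>
    have : colonBy 𝔞 (∏ u ∈ (∅ : Finset ι), γ u) = 𝔞 := by
      ext r; simp [mem_colonBy]
    rw [this] at H'
    exact H'.mono le_rfl (by simp) (by intro f; simp)
  | insert a S ha ih =>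
    have haS : a ∉ S := fun h => lt_irrefl _ (ha a h)
    rw [Finset.prod_insert haS, mul_comm, ← colonBy_colonBy] at H'
    have h1 : SpansMod M (colonBy 𝔞 (∏ u ∈ S, γ u)) (N + N')
        {f | f ∈ F ∨ ∃ g ∈ F', f = γ a * g} :=
      SpansMod.strip (hγ a) ((H a (by simp)).mono (sup_le_sup_right (le_colonBy _ _) _) le_rfl
        subset_rfl) H' (fun f hf => hf)
    refine (ih (fun u hu => H u (by simp [hu])) h1).mono le_rfl ?_ ?_
    · rw [Finset.card_insert_of_notMem haS]; apply le_of_eq; ring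
    · rintro f (⟨u, hu, g, hg, rfl⟩ | ⟨g, hg, rfl⟩)
      · rcases Finset.mem_insert.1 hu with rfl | hu
        · refine Or.inr ⟨g, Or.inl hg, ?_⟩
          rw [Finset.filter_insert, if_neg (lt_irrefl _), Finset.filter_true_of_mem ha]
        · refine Or.inl ⟨u, hu, g, hg, ?_⟩
          rw [Finset.filter_insert, if_neg (not_lt.2 (ha u hu).le)]
      · refine Or.inr ⟨γ a * g, Or.inr ⟨g, hg, rfl⟩, ?_⟩
        rw [Finset.prod_insert haS]; ring

/-- `SpansMod.chain` with the linear forms taken in decreasing order. -/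
lemma SpansMod.chain_desc {ι : Type*} [LinearOrder ι] (S : Finset ι) (γ : ι → R)
    (hγ : ∀ u, γ u ∈ M) {𝔞 : Ideal R} {N N' : ℕ} {F F' : Set R}
    (H : ∀ u ∈ S, SpansMod M (𝔞 ⊔ Ideal.span {γ u}) N F)
    (H' : SpansMod M (colonBy 𝔞 (∏ u ∈ S, γ u)) N' F') :
    SpansMod M 𝔞 (S.card * N + N')
      {f | (∃ u ∈ S, ∃ g ∈ F, f = (∏ v ∈ S with u < v, γ v) * g) ∨
        ∃ g ∈ F', f = (∏ u ∈ S, γ u) * g} :=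
  SpansMod.chain (ι := ιᵒᵈ) S γ hγ H H'

/-- `R` is generated as an algebra by the `x k`, `k ∈ T`, modulo `𝔞`. -/
def GenMod (x : ℕ → R) (𝔞 : Ideal R) (T : Finset ℕ) : Prop :=
  ∀ S : Subalgebra ℝ R, (∀ a ∈ 𝔞, a ∈ S) → (∀ k ∈ T, x k ∈ S) → S = ⊤

variable {x : ℕ → R}

lemma GenMod.mono {𝔞 𝔟 : Ideal R} {T : Finset ℕ} (H : GenMod x 𝔞 T) (h : 𝔞 ≤ 𝔟) :
    GenMod x 𝔟 T :=
  fun S hS hT => H S (fun a ha => hS a (h ha)) hT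

/-- A generator congruent to a multiple of another one is redundant. -/
lemma GenMod.erase {𝔞 : Ideal R} {T S : Finset ℕ} {a j : ℕ} (c : ℝ) (H : GenMod x 𝔞 T)
    (hT : T ⊆ insert a S) (hj : j ∈ S) (h : x a - c • x j ∈ 𝔞) : GenMod x 𝔞 S := by
  intro A hA hS
  refine H A hA fun k hk => ?_
  rcases Finset.mem_insert.1 (hT hk) with rfl | hk
  · have := A.add_mem (hA _ h) (A.smul_mem (hS j hj) c)
    simpa using this
  · exact hS k hk

lemma GenMod.erase_zero {𝔞 : Ideal R} {T S : Finset ℕ} {a : ℕ} (H : GenMod x 𝔞 T)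
    (hT : T ⊆ insert a S) (h : x a ∈ 𝔞) : GenMod x 𝔞 S := by
  intro A hA hS
  refine H A hA fun k hk => ?_
  rcases Finset.mem_insert.1 (hT hk) with rfl | hk
  · exact hA _ h
  · exact hS k hk

lemma GenMod.spansMod {𝔞 : Ideal R} (H : GenMod x 𝔞 ∅) : SpansMod M 𝔞 1 {1} := by
  have htop := H ((⊥ : Subalgebra ℝ (R ⧸ 𝔞)).comap (Ideal.Quotient.mkₐ ℝ 𝔞))
    (fun a ha => by
      have : Ideal.Quotient.mkₐ ℝ 𝔞 a = 0 := Ideal.Quotient.eq_zero_iff_mem.2 ha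
      rw [Subalgebra.mem_comap, this]
      exact zero_mem _) (by simp)
  refine ⟨{1}, by simp, by simp, by simp, fun r => ?_⟩
  have hr : r ∈ (⊥ : Subalgebra ℝ (R ⧸ 𝔞)).comap (Ideal.Quotient.mkₐ ℝ 𝔞) := by
    rw [htop]; trivial
  obtain ⟨c, hc⟩ := Algebra.mem_bot.1 (Subalgebra.mem_comap _ _ _ |>.1 hr)
  refine ⟨c • 1, Submodule.smul_mem _ _ (Submodule.subset_span (by simp)), ?_⟩
  rw [← Ideal.Quotient.eq_zero_iff_mem, map_sub, sub_eq_zero, ← Algebra.algebraMap_eq_smul_one]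
  exact hc.symm

/-- The weighted power sum `∑_{k ∈ T} w_k x_k^{2m}`. -/
def psumW (x : ℕ → R) (w : ℕ → ℝ) (T : Finset ℕ) (m : ℕ) : R :=
  ∑ k ∈ T, w k • x k ^ (2 * m)

lemma smul_mem_ideal {𝔞 : Ideal R} (c : ℝ) {r : R} (h : r ∈ 𝔞) : c • r ∈ 𝔞 := by
  rw [Algebra.smul_def]; exact 𝔞.mul_mem_left _ h

lemma psumW_merge {𝔞 : Ideal R} {w : ℕ → ℝ} {S : Finset ℕ} {a j m : ℕ} (ha : a ∉ S) (hj : j ∈ S)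
    (h : x a ^ 2 - x j ^ 2 ∈ 𝔞) (hp : psumW x w (insert a S) m ∈ 𝔞) :
    psumW x (Function.update w j (w j + w a)) S m ∈ 𝔞 := by
  have hd : x a ^ (2 * m) - x j ^ (2 * m) ∈ 𝔞 := by
    rw [pow_mul, pow_mul]
    exact 𝔞.mem_of_dvd (sub_dvd_pow_sub_pow _ _ _) h
  have : psumW x (Function.update w j (w j + w a)) S m
      = psumW x w (insert a S) m - w a • (x a ^ (2 * m) - x j ^ (2 * m)) := by
    unfold psumW
    rw [Finset.sum_insert ha, ← Finset.add_sum_erase _ _ hj, ← Finset.add_sum_erase S _ hj,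
      Finset.sum_congr rfl (g := fun k => w k • x k ^ (2 * m))]
    · simp only [Function.update_self, add_smul, smul_sub]; ring
    · intro k hk
      rw [Function.update_of_ne (Finset.ne_of_mem_erase hk)]
  rw [this]
  exact sub_mem hp (smul_mem_ideal _ hd)

lemma psumW_drop {𝔞 : Ideal R} {w : ℕ → ℝ} {S : Finset ℕ} {a m : ℕ} (ha : a ∉ S) (hm : 1 ≤ m)
    (h : x a ∈ 𝔞) (hp : psumW x w (insert a S) m ∈ 𝔞) : psumW x w S m ∈ 𝔞 := by
  have : psumW x w S m = psumW x w (insert a S) m - w a • x a ^ (2 * m) := by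
    unfold psumW
    rw [Finset.sum_insert ha]; ring
  rw [this]
  exact sub_mem hp (smul_mem_ideal _ (𝔞.pow_mem_of_mem h _ (by omega)))

/-- The weighted sum of the values `q(x_k²)`, up to its constant part, is a combination of the
power sums. -/
lemma sum_eval_sq_sub_mem {𝔞 : Ideal R} {w : ℕ → ℝ} {T : Finset ℕ} {d : ℕ}
    (hp : ∀ m ∈ Finset.Icc 1 d, psumW x w T m ∈ 𝔞) (q : Polynomial R) (hq : q.natDegree ≤ d) :
    ∑ k ∈ T, w k • q.eval (x k ^ 2) - (∑ k ∈ T, w k) • q.coeff 0 ∈ 𝔞 := by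
  have : ∑ k ∈ T, w k • q.eval (x k ^ 2) - (∑ k ∈ T, w k) • q.coeff 0
      = ∑ m ∈ Finset.range d, q.coeff (m + 1) * psumW x w T (m + 1) := by
    simp only [Polynomial.eval_eq_sum_range' (Nat.lt_succ_of_le hq), Finset.sum_range_succ',
      smul_add, Finset.sum_add_distrib, pow_zero, mul_one, Finset.sum_smul, psumW]
    rw [add_sub_cancel_right]
    simp only [Finset.smul_sum, Finset.mul_sum]
    rw [Finset.sum_comm]
    refine Finset.sum_congr rfl fun m _ => Finset.sum_congr rfl fun k _ => ?_
    rw [mul_smul_comm, pow_mul]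
  rw [this]
  refine sum_mem fun m hm => 𝔞.mul_mem_left _ (hp _ ?_)
  simp only [Finset.mem_range] at hm
  simp only [Finset.mem_Icc]; omega

lemma smul_prod_sq_sub_mem {𝔞 : Ideal R} {w : ℕ → ℝ} {S : Finset ℕ} {a : ℕ} (ha : a ∉ S)
    (hp : ∀ m ∈ Finset.Icc 1 S.card, psumW x w (insert a S) m ∈ 𝔞) :
    w a • ∏ l ∈ S, (x a ^ 2 - x l ^ 2)
      - (∑ k ∈ insert a S, w k) • ((-1) ^ S.card * (∏ l ∈ S, x l) ^ 2) ∈ 𝔞 := by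
  have := sum_eval_sq_sub_mem hp (∏ l ∈ S, (Polynomial.X - Polynomial.C (x l ^ 2)))
    (natDegree_prod_X_sub_C_le S _)
  rw [Finset.sum_insert ha, Finset.sum_eq_zero (s := S), add_zero] at this
  · convert this using 3
    · simp [Polynomial.eval_prod]
    · simp [Polynomial.coeff_zero_eq_eval_zero, Polynomial.eval_prod, Finset.prod_neg,
        Finset.prod_pow]
  · intro k hk
    rw [Polynomial.eval_prod, Finset.prod_eq_zero hk (by simp), smul_zero]

lemma smul_sq_mul_prod_sq_sub_mem {𝔞 : Ideal R} {w : ℕ → ℝ} {S : Finset ℕ} {a : ℕ} (ha : a ∉ S)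
    (hp : ∀ m ∈ Finset.Icc 1 (S.card + 1), psumW x w (insert a S) m ∈ 𝔞) :
    w a • (x a ^ 2 * ∏ l ∈ S, (x a ^ 2 - x l ^ 2)) ∈ 𝔞 := by
  have := sum_eval_sq_sub_mem hp
    (Polynomial.X * ∏ l ∈ S, (Polynomial.X - Polynomial.C (x l ^ 2)))
    ((Polynomial.natDegree_mul_le.trans (add_le_add Polynomial.natDegree_X_le
      (natDegree_prod_X_sub_C_le S _))).trans (by omega))
  rw [Finset.sum_insert ha, Finset.sum_eq_zero (s := S), add_zero] at this
  · simpa [Polynomial.eval_prod] using this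
  · intro k hk
    rw [Polynomial.eval_mul, Polynomial.eval_prod, Finset.prod_eq_zero hk (by simp), mul_zero,
      smul_zero]

end Spanning

section SpanningB

variable {R : Type*} [CommRing R] [Algebra ℝ R] {M : Submonoid R} {x : ℕ → R}

lemma mem_ideal_of_smul_mem {𝔞 : Ideal R} {c : ℝ} (hc : c ≠ 0) {r : R} (h : c • r ∈ 𝔞) :
    r ∈ 𝔞 := by
  simpa [smul_smul, inv_mul_cancel₀ hc] using smul_mem_ideal c⁻¹ h

/-- The products `∏_{i ∈ T} ∏_{l ∈ T, i < l ≤ c_i} (x_i + x_l)`. -/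
def famB (x : ℕ → R) (T : Finset ℕ) : Set R :=
  {r | ∃ c : ℕ → ℕ, r = ∏ i ∈ T, ∏ l ∈ T with i < l ∧ l ≤ c i, (x i + x l)}

lemma update_add_pos {w : ℕ → ℝ} (hw : ∀ k, 0 < w k) (a j : ℕ) (k : ℕ) :
    0 < Function.update w j (w j + w a) k := by
  rcases eq_or_ne k j with rfl | h
  · simpa using add_pos (hw k) (hw a)
  · simpa [Function.update_of_ne h] using hw k

/-- The ring defined by the weighted power sums of degrees `2, 4, …, 2|T|` in the variables
`x_k`, `k ∈ T`, is spanned by `2^|T| |T|!` elements. -/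
lemma spansMod_psumW (hx : ∀ k, x k ∈ M) (hadd : ∀ k l, x k + x l ∈ M)
    (hsub : ∀ k l, x k - x l ∈ M) (T : Finset ℕ) :
    ∀ (w : ℕ → ℝ) (_ : ∀ k, 0 < w k) (𝔞 : Ideal R) (_ : GenMod x 𝔞 T)
      (_ : ∀ m ∈ Finset.Icc 1 T.card, psumW x w T m ∈ 𝔞),
      SpansMod M 𝔞 (2 ^ T.card * T.card.factorial) (famB x T) := by
  induction T using Finset.induction_on_min with
  | empty =>
    intro w hw 𝔞 hg _
    exact hg.spansMod.mono le_rfl (by simp) (by rintro _ ⟨c, rfl⟩; simp)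
  | insert a S ha ih =>
    intro w hw 𝔞 hg hp
    have haS : a ∉ S := fun h => lt_irrefl _ (ha a h)
    rw [Finset.card_insert_of_notMem haS] at hp ⊢
    set N := 2 ^ S.card * S.card.factorial with hN
    have hmerge : ∀ 𝔟 : Ideal R, 𝔞 ≤ 𝔟 → ∀ j ∈ S, ∀ c : ℝ, x a - c • x j ∈ 𝔟 →
        x a ^ 2 - x j ^ 2 ∈ 𝔟 → SpansMod M 𝔟 N (famB x S) := by
      intro 𝔟 h𝔟 j hj c h1 h2
      refine ih _ (update_add_pos hw a j) 𝔟 ((hg.mono h𝔟).erase c subset_rfl hj h1) fun m hm => ?_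
      refine psumW_merge haS hj h2 (h𝔟 (hp m ?_))
      simp only [Finset.mem_Icc] at hm ⊢; omega
    have hzero : ∀ 𝔟 : Ideal R, 𝔞 ≤ 𝔟 → x a ∈ 𝔟 → SpansMod M 𝔟 N (famB x S) := by
      intro 𝔟 h𝔟 h1
      refine ih w hw 𝔟 ((hg.mono h𝔟).erase_zero subset_rfl h1) fun m hm => ?_
      simp only [Finset.mem_Icc] at hm
      refine psumW_drop haS hm.1 h1 (h𝔟 (hp m ?_))
      simp only [Finset.mem_Icc]; omega
    have hplus : ∀ 𝔟 : Ideal R, 𝔞 ≤ 𝔟 → ∀ j ∈ S,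
        SpansMod M (𝔟 ⊔ Ideal.span {x a + x j}) N (famB x S) := by
      intro 𝔟 h𝔟 j hj
      have h := mem_sup_span_self 𝔟 (x a + x j)
      refine hmerge _ (h𝔟.trans le_sup_left) j hj (-1) (by simpa using h) ?_
      rw [sq_sub_sq]
      exact Ideal.mul_mem_right _ _ h
    have hminus : ∀ 𝔟 : Ideal R, 𝔞 ≤ 𝔟 → ∀ j ∈ S,
        SpansMod M (𝔟 ⊔ Ideal.span {x a - x j}) N (famB x S) := by
      intro 𝔟 h𝔟 j hj
      have h := mem_sup_span_self 𝔟 (x a - x j)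
      refine hmerge _ (h𝔟.trans le_sup_left) j hj 1 (by simpa using h) ?_
      rw [sq_sub_sq]
      exact Ideal.mul_mem_left _ _ h
    set πp := ∏ u ∈ S, (x a + x u) with hπp
    have h𝔞1 : 𝔞 ≤ colonBy 𝔞 πp := le_colonBy _ _
    have h𝔞2 : 𝔞 ≤ colonBy (colonBy 𝔞 πp) (x a) := h𝔞1.trans (le_colonBy _ _)
    have h𝔞3 : 𝔞 ≤ colonBy (colonBy (colonBy 𝔞 πp) (x a)) (x a) := h𝔞2.trans (le_colonBy _ _)
    have hone : SpansMod M (colonBy (colonBy (colonBy (colonBy 𝔞 πp) (x a)) (x a))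
        (∏ u ∈ S, (x a - x u))) 0 ∅ := by
      refine spansMod_of_one_mem ?_
      simp only [mem_colonBy]
      have := mem_ideal_of_smul_mem (hw a).ne' (smul_sq_mul_prod_sq_sub_mem haS hp)
      convert this using 1
      simp only [sq_sub_sq, Finset.prod_mul_distrib]
      ring
    have h4 := SpansMod.chain S (fun u => x a - x u) (fun u => hsub _ _)
      (fun u hu => hminus _ h𝔞3 u hu) hone
    have h3 : SpansMod M (colonBy (colonBy 𝔞 πp) (x a)) (N + (S.card * N + 0)) ∅ :=
      SpansMod.strip (hx a) (hzero _ (h𝔞2.trans le_sup_left) (mem_sup_span_self _ _)) h4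
        (by simp)
    have h2 : SpansMod M (colonBy 𝔞 πp) (N + (N + (S.card * N + 0))) (famB x S) :=
      SpansMod.strip (hx a) (hzero _ (h𝔞1.trans le_sup_left) (mem_sup_span_self _ _)) h3
        (fun f hf => Or.inl hf)
    refine (SpansMod.chain S (fun u => x a + x u) (fun u => hadd _ _)
      (fun u hu => hplus _ le_rfl u hu) h2).mono le_rfl ?_ ?_
    · rw [Nat.factorial_succ, pow_succ]
      apply le_of_eq
      calc _ = (2 * S.card + 2) * N := by ring
        _ = _ := by rw [hN]; ring
    · rintro _ ⟨c, rfl⟩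
      have hfirst : ({l ∈ insert a S | a < l ∧ l ≤ c a} : Finset ℕ) = {l ∈ S | l ≤ c a} := by
        ext l
        simp only [Finset.mem_filter, Finset.mem_insert]
        constructor
        · rintro ⟨rfl | h, h1, h2⟩
          · exact absurd h1 (lt_irrefl _)
          · exact ⟨h, h2⟩
        · rintro ⟨h, h2⟩
          exact ⟨Or.inr h, ha l h, h2⟩
      have hrest : ∏ i ∈ S, ∏ l ∈ insert a S with i < l ∧ l ≤ c i, (x i + x l)
          = ∏ i ∈ S, ∏ l ∈ S with i < l ∧ l ≤ c i, (x i + x l) := by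
        refine Finset.prod_congr rfl fun i hi => ?_
        rw [Finset.filter_insert, if_neg]
        exact fun h => lt_asymm h.1 (ha i hi)
      rw [Finset.prod_insert haS, hfirst, hrest]
      have hmem : ∏ i ∈ S, ∏ l ∈ S with i < l ∧ l ≤ c i, (x i + x l) ∈ famB x S := ⟨c, rfl⟩
      by_cases hne : ({l ∈ S | c a < l} : Finset ℕ).Nonempty
      · left
        have hmin := Finset.min'_mem _ hne
        set u := Finset.min' _ hne with hu
        simp only [Finset.mem_filter] at hmin
        refine ⟨u, hmin.1, _, hmem, ?_⟩
        congr 2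
        ext l
        simp only [Finset.mem_filter, and_congr_right_iff]
        intro hl
        constructor
        · intro h; omega
        · intro h
          by_contra hc
          have := Finset.min'_le ({l ∈ S | c a < l} : Finset ℕ) l (by simp [hl]; omega)
          omega
      · right
        refine ⟨_, hmem, ?_⟩
        rw [Finset.filter_true_of_mem]
        intro l hl
        by_contra hc
        exact hne ⟨l, by simp [hl]; omega⟩

end SpanningB

section SpanningD

variable {R : Type*} [CommRing R] {x : ℕ → R}

/-- The root labels of type `D_n` in arbitrary elements `x_1, …, x_n` of a ring. -/
def rootD (x : ℕ → R) (n i j : ℕ) : R :=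
  if i = n then x (2 * n - j) + x n
  else if j ≤ n then x i - x j
  else x i + x (2 * n - j)

/-- Hessenberg functions for the root system of type `D` in the variables `x_s, …, x_n`. -/
structure HessFrom (n s : ℕ) (h : ℕ → ℕ) : Prop where
  bounds : ∀ i, s ≤ i → i < n → i ≤ h i ∧ h i ≤ 2 * n - 1 - i
  last : n ≤ h n ∧ h n ≤ 2 * n - s
  step : ∀ i, s ≤ i → i + 2 ≤ n → h i ≠ 2 * n - 1 - i → h i ≤ h (i + 1)
  full : ∀ i, s ≤ i → i + 2 ≤ n → h i = 2 * n - 1 - i → h (i + 1) = 2 * n - 1 - (i + 1)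
  last_ge : ∀ i, s ≤ i → i + 2 ≤ n → n + 1 ≤ h i → 2 * n - i ≤ h n
  of_last_ge : ∀ i, s ≤ i → i + 2 ≤ n → 2 * n - i ≤ h n → n - 1 ≤ h i

/-- The product of the roots in the variables `x_s, …, x_n` outside the lower ideal `h`. -/
def classD (x : ℕ → R) (n s : ℕ) (h : ℕ → ℕ) : R :=
  (∏ i ∈ Finset.Ico s n, ∏ j ∈ Finset.Icc (h i + 1) (2 * n - 1 - i), rootD x n i j) *
    ∏ j ∈ Finset.Icc (h n + 1) (2 * n - s), rootD x n n j

/-- The classes of all lower ideals. -/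
def famD (x : ℕ → R) (n s : ℕ) : Set R :=
  {r | ∃ h, HessFrom n s h ∧ r = classD x n s h}

lemma prod_row_of_le {n s a : ℕ} (hs : s < n) (ha : n ≤ a) :
    ∏ j ∈ Finset.Icc (a + 1) (2 * n - 1 - s), rootD x n s j
      = ∏ l ∈ Finset.Icc (s + 1) (n - 1) with l < 2 * n - a, (x s + x l) := by
  refine Finset.prod_nbij' (fun j => 2 * n - j) (fun l => 2 * n - l) ?_ ?_ ?_ ?_ ?_
  all_goals intro j hj
  all_goals simp only [Finset.mem_Icc, Finset.mem_filter] at hj ⊢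
  any_goals omega
  rw [rootD, if_neg (by omega), if_neg (by omega)]

lemma prod_row_of_lt {n s a : ℕ} (hs : s < n) (hsa : s ≤ a) (ha : a < n) :
    ∏ j ∈ Finset.Icc (a + 1) (2 * n - 1 - s), rootD x n s j
      = (∏ l ∈ Finset.Icc (s + 1) (n - 1), (x s + x l)) * ((x s - x n) *
        ∏ l ∈ Finset.Icc (s + 1) (n - 1) with a < l, (x s - x l)) := by
  have hsplit : Finset.Icc (a + 1) (2 * n - 1 - s)
      = Finset.Icc (n + 1) (2 * n - 1 - s) ∪
        insert n (Finset.Icc (s + 1) (n - 1) |>.filter (a < ·)) := by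
    ext j
    simp only [Finset.mem_Icc, Finset.mem_union, Finset.mem_insert, Finset.mem_filter]
    omega
  rw [hsplit, Finset.prod_union, Finset.prod_insert, prod_row_of_le hs le_rfl]
  · congr 2
    · rw [Finset.filter_true_of_mem]
      intro l hl
      simp only [Finset.mem_Icc] at hl; omega
    · rw [rootD, if_neg (by omega), if_pos le_rfl]
    · refine Finset.prod_congr rfl fun l hl => ?_
      simp only [Finset.mem_Icc, Finset.mem_filter] at hl
      rw [rootD, if_neg (by omega), if_pos (by omega)]
  · simp only [Finset.mem_Icc, Finset.mem_filter]; omega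
  · rw [Finset.disjoint_left]
    intro j
    simp only [Finset.mem_Icc, Finset.mem_insert, Finset.mem_filter]; omega

lemma HessFrom.succ {n s : ℕ} {h : ℕ → ℕ} (H : HessFrom n s h) (hb : h n ≤ 2 * n - (s + 1)) :
    HessFrom n (s + 1) h where
  bounds i hi := H.bounds i (by omega)
  last := ⟨H.last.1, hb⟩
  step i hi := H.step i (by omega)
  full i hi := H.full i (by omega)
  last_ge i hi := H.last_ge i (by omega)
  of_last_ge i hi := H.of_last_ge i (by omega)

lemma HessFrom.succ_update {n s : ℕ} {h : ℕ → ℕ} (hs : s < n) (H : HessFrom n s h)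
    (hb : h n = 2 * n - s) :
    HessFrom n (s + 1) (Function.update h n (2 * n - (s + 1))) := by
  have hne : ∀ i, i < n → Function.update h n (2 * n - (s + 1)) i = h i :=
    fun i hi => Function.update_of_ne hi.ne _ _
  have hself : Function.update h n (2 * n - (s + 1)) n = 2 * n - (s + 1) :=
    Function.update_self _ _ _
  refine ⟨fun i hi hn => ?_, ?_, fun i hi hn => ?_, fun i hi hn => ?_, fun i hi hn => ?_,
    fun i hi hn => ?_⟩
  · rw [hne i hn]; exact H.bounds i (by omega) hn
  · rw [hself]; omega
  · rw [hne i (by omega), hne (i + 1) (by omega)]; exact H.step i (by omega) hn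
  · rw [hne i (by omega), hne (i + 1) (by omega)]; exact H.full i (by omega) hn
  · rw [hself]; intro; omega
  · rw [hne i (by omega)]; intro; exact H.of_last_ge i (by omega) hn (by omega)

lemma classD_of_last_lt {n s : ℕ} {h : ℕ → ℕ} (hs : s < n) (hb : h n ≤ 2 * n - (s + 1)) :
    classD x n s h = (∏ j ∈ Finset.Icc (h s + 1) (2 * n - 1 - s), rootD x n s j) *
      ((x s + x n) * classD x n (s + 1) h) := by
  have h2 : ∏ j ∈ Finset.Icc (h n + 1) (2 * n - s), rootD x n n j
      = (∏ j ∈ Finset.Icc (h n + 1) (2 * n - (s + 1)), rootD x n n j) * (x s + x n) := by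
    have h1 : 2 * n - s = 2 * n - (s + 1) + 1 := by omega
    rw [h1, Finset.prod_Icc_succ_top (by omega), ← h1, rootD, if_pos rfl,
      show 2 * n - (2 * n - s) = s by omega]
  rw [classD, classD, Finset.prod_eq_prod_Ico_succ_bot hs, h2]
  ring

lemma classD_of_last_eq {n s : ℕ} {h : ℕ → ℕ} (hs : s < n) (hb : h n = 2 * n - s) :
    classD x n s h = (∏ j ∈ Finset.Icc (h s + 1) (2 * n - 1 - s), rootD x n s j) *
      ∏ i ∈ Finset.Ico (s + 1) n, ∏ j ∈ Finset.Icc (h i + 1) (2 * n - 1 - i), rootD x n i j := by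
  have h2 : ∏ j ∈ Finset.Icc (h n + 1) (2 * n - s), rootD x n n j = 1 := by
    rw [Finset.Icc_eq_empty (by omega), Finset.prod_empty]
  rw [classD, Finset.prod_eq_prod_Ico_succ_bot hs, h2, mul_one]

lemma prod_rows_mem_famD {n s : ℕ} {h : ℕ → ℕ} (hs : s < n) (H : HessFrom n s h)
    (hb : h n = 2 * n - s) :
    ∏ i ∈ Finset.Ico (s + 1) n, ∏ j ∈ Finset.Icc (h i + 1) (2 * n - 1 - i), rootD x n i j
      ∈ famD x n (s + 1) := by
  refine ⟨_, H.succ_update hs hb, ?_⟩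
  rw [classD, Function.update_self, Finset.Icc_eq_empty (by omega), Finset.prod_empty, mul_one]
  refine Finset.prod_congr rfl fun i hi => ?_
  rw [Function.update_of_ne (Finset.mem_Ico.1 hi).2.ne]

lemma HessFrom.le_row {n s : ℕ} {h : ℕ → ℕ} (H : HessFrom n s h) (hns : n ≤ h s) :
    ∀ i, s ≤ i → i < n → n ≤ h i := by
  intro i hi
  induction i, hi using Nat.le_induction with
  | base => exact fun _ => hns
  | succ i hi ih =>
    intro hn
    have h1 := ih (by omega)
    by_cases hf : h i = 2 * n - 1 - i
    · have := H.full i hi (by omega) hf; omega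
    · exact h1.trans (H.step i hi (by omega) hf)

lemma prod_rows_mem_famB {n s : ℕ} {h : ℕ → ℕ} (hs : s < n) (H : HessFrom n s h)
    (hns : n ≤ h s) :
    ∏ i ∈ Finset.Ico (s + 1) n, ∏ j ∈ Finset.Icc (h i + 1) (2 * n - 1 - i), rootD x n i j
      ∈ famB x (Finset.Icc (s + 1) (n - 1)) := by
  refine ⟨fun i => 2 * n - 1 - h i, ?_⟩
  rw [show Finset.Ico (s + 1) n = Finset.Icc (s + 1) (n - 1) by
    ext; simp only [Finset.mem_Ico, Finset.mem_Icc]; omega]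
  refine Finset.prod_congr rfl fun i hi => ?_
  simp only [Finset.mem_Icc] at hi
  have h1 := H.le_row hns i (by omega) (by omega)
  rw [prod_row_of_le (by omega) h1]
  refine Finset.prod_congr ?_ fun _ _ => rfl
  ext l
  simp only [Finset.mem_filter, Finset.mem_Icc]
  omega

lemma mul_prod_add_sub_mem {𝔞 : Ideal R} {t e : R} (h : t * e ∈ 𝔞) (A : Finset ℕ) (y : ℕ → R) :
    e * ∏ l ∈ A, (t + y l) - e * ∏ l ∈ A, y l ∈ 𝔞 := by
  classical
  induction A using Finset.induction_on with
  | empty => simp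
  | insert a A ha ih =>
    rw [Finset.prod_insert ha, Finset.prod_insert ha]
    have : e * ((t + y a) * ∏ l ∈ A, (t + y l)) - e * (y a * ∏ l ∈ A, y l)
        = (∏ l ∈ A, (t + y l)) * (t * e) + y a * (e * ∏ l ∈ A, (t + y l) - e * ∏ l ∈ A, y l) := by
      ring
    rw [this]
    exact add_mem (𝔞.mul_mem_left _ h) (𝔞.mul_mem_left _ ih)

variable [Algebra ℝ R] {M : Submonoid R}

/-- The ring defined by the weighted power sums of degrees `2, 4, …, 2(n-s)` and the product of
the variables `x_s, …, x_n` is spanned by `2^(n-s) (n-s+1)!` elements, among which are the classes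
of all lower ideals. -/
lemma spansMod_famD (hx : ∀ k, x k ∈ M) (hadd : ∀ k l, x k + x l ∈ M)
    (hsub : ∀ k l, x k - x l ∈ M) (n k : ℕ) :
    ∀ (s : ℕ) (_ : s + k = n) (w : ℕ → ℝ) (_ : ∀ i, 0 < w i) (𝔞 : Ideal R)
      (_ : GenMod x 𝔞 (Finset.Icc s n)) (_ : ∏ i ∈ Finset.Icc s n, x i ∈ 𝔞)
      (_ : ∀ m ∈ Finset.Icc 1 k, psumW x w (Finset.Icc s n) m ∈ 𝔞),
      SpansMod M 𝔞 (2 ^ k * (k + 1).factorial) (famD x n s) := by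
  induction k with
  | zero =>
    intro s hs w hw 𝔞 hg he _
    obtain rfl : s = n := by omega
    simp only [Finset.Icc_self, Finset.prod_singleton] at hg he
    refine (hg.erase_zero (S := ∅) (by simp) he).spansMod.mono le_rfl (by simp) ?_
    rintro _ ⟨h, H, rfl⟩
    have := H.last
    rw [classD, Finset.Ico_self, Finset.Icc_eq_empty (by omega)]
    simp
  | succ k ih =>
    intro s hs w hw 𝔞 hg he hp
    have hsn : s < n := by omega
    set S := Finset.Icc (s + 1) n with hS
    set S₀ := Finset.Icc (s + 1) (n - 1) with hS₀
    have hT : Finset.Icc s n = insert s S := by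
      ext; simp only [hS, Finset.mem_Icc, Finset.mem_insert]; omega
    have hSn : S = insert n S₀ := by
      ext; simp only [hS, hS₀, Finset.mem_Icc, Finset.mem_insert]; omega
    have hsS : s ∉ S := by simp [hS]
    have hnS₀ : n ∉ S₀ := by simp only [hS₀, Finset.mem_Icc]; omega
    have hnS : n ∈ S := by simp [hSn]
    have hS₀S : ∀ j ∈ S₀, j ∈ S := fun j hj => by simp [hSn, hj]
    have hcS : S.card = k + 1 := by rw [hS, Nat.card_Icc]; omega
    have hcS₀ : S₀.card = k := by rw [hS₀, Nat.card_Icc]; omega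
    rw [hT] at hg he hp
    rw [Finset.prod_insert hsS] at he
    set e := ∏ i ∈ S, x i with hedef
    have heM : e ∈ M := M.prod_mem fun i _ => hx i
    set ND := 2 ^ k * (k + 1).factorial with hND
    set NB := 2 ^ k * k.factorial with hNB
    set W := ∑ i ∈ insert s S, w i with hW
    have hWpos : 0 < W := Finset.sum_pos (fun i _ => hw i) (by simp)
    have hmerge : ∀ 𝔟 : Ideal R, 𝔞 ≤ 𝔟 → ∀ j ∈ S, ∀ c : ℝ, x s - c • x j ∈ 𝔟 →
        x s ^ 2 - x j ^ 2 ∈ 𝔟 → GenMod x 𝔟 S ∧ ∃ w' : ℕ → ℝ, (∀ i, 0 < w' i) ∧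
          ∀ m ∈ Finset.Icc 1 k, psumW x w' S m ∈ 𝔟 := by
      intro 𝔟 h𝔟 j hj c h1 h2
      refine ⟨(hg.mono h𝔟).erase c subset_rfl hj h1, _, update_add_pos hw s j, fun m hm => ?_⟩
      refine psumW_merge hsS hj h2 (h𝔟 (hp m ?_))
      simp only [Finset.mem_Icc] at hm ⊢; omega
    have hplus : ∀ 𝔟 : Ideal R, 𝔞 ≤ 𝔟 → ∀ j ∈ S, x s + x j ∈ 𝔟 →
        GenMod x 𝔟 S ∧ ∃ w' : ℕ → ℝ, (∀ i, 0 < w' i) ∧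
          ∀ m ∈ Finset.Icc 1 k, psumW x w' S m ∈ 𝔟 := by
      intro 𝔟 h𝔟 j hj h
      refine hmerge 𝔟 h𝔟 j hj (-1) (by simpa using h) ?_
      rw [sq_sub_sq]
      exact Ideal.mul_mem_right _ _ h
    have hminus : ∀ 𝔟 : Ideal R, 𝔞 ≤ 𝔟 → ∀ j ∈ S, x s - x j ∈ 𝔟 →
        GenMod x 𝔟 S ∧ ∃ w' : ℕ → ℝ, (∀ i, 0 < w' i) ∧
          ∀ m ∈ Finset.Icc 1 k, psumW x w' S m ∈ 𝔟 := by
      intro 𝔟 h𝔟 j hj h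
      refine hmerge 𝔟 h𝔟 j hj 1 (by simpa using h) ?_
      rw [sq_sub_sq]
      exact Ideal.mul_mem_left _ _ h
    have hzero : ∀ 𝔟 : Ideal R, 𝔞 ≤ 𝔟 → x s ∈ 𝔟 →
        GenMod x 𝔟 S ∧ ∃ w' : ℕ → ℝ, (∀ i, 0 < w' i) ∧
          ∀ m ∈ Finset.Icc 1 k, psumW x w' S m ∈ 𝔟 := by
      intro 𝔟 h𝔟 h
      refine ⟨(hg.mono h𝔟).erase_zero subset_rfl h, w, hw, fun m hm => ?_⟩
      simp only [Finset.mem_Icc] at hm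
      refine psumW_drop hsS hm.1 h (h𝔟 (hp m ?_))
      simp only [Finset.mem_Icc]; omega
    have hD : ∀ 𝔟 : Ideal R, (GenMod x 𝔟 S ∧ ∃ w' : ℕ → ℝ, (∀ i, 0 < w' i) ∧
        ∀ m ∈ Finset.Icc 1 k, psumW x w' S m ∈ 𝔟) → e ∈ 𝔟 →
        SpansMod M 𝔟 ND (famD x n (s + 1)) := by
      rintro 𝔟 ⟨hg', w', hw', hp'⟩ he'
      exact ih (s + 1) (by omega) w' hw' 𝔟 hg' he' hp'
    have hB : ∀ 𝔟 : Ideal R, (GenMod x 𝔟 S ∧ ∃ w' : ℕ → ℝ, (∀ i, 0 < w' i) ∧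
        ∀ m ∈ Finset.Icc 1 k, psumW x w' S m ∈ 𝔟) → ∀ j ∈ S, x j ∈ 𝔟 →
        SpansMod M 𝔟 NB (famB x (S.erase j)) := by
      rintro 𝔟 ⟨hg', w', hw', hp'⟩ j hj hxj
      have hc : (S.erase j).card = k := by rw [Finset.card_erase_of_mem hj, hcS]; rfl
      rw [← Finset.insert_erase hj] at hg' hp'
      have := spansMod_psumW hx hadd hsub (S.erase j) w' hw' 𝔟
        (hg'.erase_zero subset_rfl hxj) (fun m hm => by
          rw [hc] at hm
          exact psumW_drop (Finset.notMem_erase j S) (Finset.mem_Icc.1 hm).1 hxj (hp' m hm))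
      rwa [hc] at this
    have hF : w s • ∏ l ∈ S, (x s ^ 2 - x l ^ 2) - W • ((-1) ^ (k + 1) * e ^ 2) ∈ 𝔞 := by
      have := smul_prod_sq_sub_mem hsS (w := w) (𝔞 := 𝔞) (x := x) (by rwa [hcS])
      rwa [hcS] at this
    set π := ∏ u ∈ S₀, (x s + x u) with hπ
    set ρ := ∏ u ∈ S₀, (x s - x u) with hρ
    have hprod : ∏ l ∈ S, (x s ^ 2 - x l ^ 2) = π * ((x s - x n) * ((x s + x n) * ρ)) := by
      rw [hSn, Finset.prod_insert hnS₀]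
      simp only [sq_sub_sq, Finset.prod_mul_distrib]
      ring
    have hminusS : ∏ l ∈ S, (x s - x l) = (x s - x n) * ρ := by
      rw [hSn, Finset.prod_insert hnS₀]
    have heS₀ : e = x n * ∏ l ∈ S₀, x l := by
      rw [hedef, hSn, Finset.prod_insert hnS₀]
    have hπe : e * π - e * ∏ l ∈ S₀, x l ∈ 𝔞 := mul_prod_add_sub_mem he S₀ x
    -- the generators of the successive colon ideals
    have hG : w s • (ρ * (x s + x n)) + W • ((-1) ^ (k + 1) * e) ∈
        colonBy (colonBy 𝔞 π) (x s - x n) := by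
      simp only [mem_colonBy]
      rw [hprod] at hF
      have h2 : W • ((-1) ^ (k + 1) * (π * (x s * e)
          - x n * (e * π - e * ∏ l ∈ S₀, x l))) ∈ 𝔞 :=
        smul_mem_ideal _ (𝔞.mul_mem_left _ (sub_mem (𝔞.mul_mem_left _ he)
          (𝔞.mul_mem_left _ hπe)))
      convert add_mem hF h2 using 1
      simp only [Algebra.smul_def]
      linear_combination (algebraMap ℝ R W * (-1) ^ (k + 1) * e) * heS₀
    have hK : w s • ((x s - x n) * ρ) - W • ((-1) ^ (k + 1) * e) ∈
        colonBy (colonBy (colonBy 𝔞 π) (x s - x n)) (x s + x n) := by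
      simp only [mem_colonBy]
      rw [hprod] at hF
      have h2 : W • ((-1) ^ (k + 1) * (π * (x s * e)
          + x n * (e * π - e * ∏ l ∈ S₀, x l))) ∈ 𝔞 :=
        smul_mem_ideal _ (𝔞.mul_mem_left _ (add_mem (𝔞.mul_mem_left _ he)
          (𝔞.mul_mem_left _ hπe)))
      convert 𝔞.mul_mem_left (x s - x n) (sub_mem hF h2) using 1
      simp only [Algebra.smul_def]
      linear_combination ((x s - x n) * algebraMap ℝ R W * (-1) ^ (k + 1) * e) * heS₀
    have hX : x s ∈ colonBy (colonBy (colonBy (colonBy 𝔞 π) (x s - x n)) (x s + x n)) ρ := by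
      simp only [mem_colonBy]
      refine mem_ideal_of_smul_mem (hw s).ne' ?_
      rw [hprod] at hF
      have h2 : W • ((-1) ^ (k + 1) * (e * (x s * e))) ∈ 𝔞 :=
        smul_mem_ideal _ (𝔞.mul_mem_left _ (𝔞.mul_mem_left _ he))
      convert add_mem (𝔞.mul_mem_left (x s) hF) h2 using 1
      simp only [Algebra.smul_def]
      ring
    set 𝔟 := colonBy 𝔞 π with h𝔟
    set 𝔠 := colonBy 𝔟 (x s - x n) with h𝔠
    set 𝔡 := colonBy 𝔠 (x s + x n) with h𝔡
    have l1 : 𝔞 ≤ 𝔟 := le_colonBy _ _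
    have l2 : 𝔞 ≤ 𝔠 := l1.trans (le_colonBy _ _)
    have l3 : 𝔞 ≤ 𝔡 := l2.trans (le_colonBy _ _)
    have l4 : 𝔞 ≤ colonBy 𝔡 ρ := l3.trans (le_colonBy _ _)
    have hsign : ∀ (𝔯 : Ideal R) (c : ℝ), c ≠ 0 → c • ((-1) ^ (k + 1) * e) ∈ 𝔯 → e ∈ 𝔯 := by
      intro 𝔯 c hc h
      have := 𝔯.mul_mem_left ((-1) ^ (k + 1)) (mem_ideal_of_smul_mem hc h)
      rwa [← mul_assoc, ← mul_pow, neg_one_mul, neg_neg, one_pow, one_mul] at this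
    have final : SpansMod M (colonBy 𝔡 ρ) ND (famD x n (s + 1)) := by
      refine hD _ (hzero _ l4 hX) (hsign _ (W - w s) ?_ ?_)
      · rw [hW, Finset.sum_insert hsS, add_sub_cancel_left]
        exact (Finset.sum_pos (fun i _ => hw i) ⟨n, hnS⟩).ne'
      · have h1 := mul_prod_add_sub_mem (e := 1) (𝔞 := colonBy 𝔡 ρ) (by simpa using hX) S
          (fun l => - x l)
        simp only [← sub_eq_add_neg, one_mul, hminusS, Finset.prod_neg, hcS] at h1
        convert sub_mem (smul_mem_ideal (w s) h1) (le_colonBy 𝔡 ρ hK) using 1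
        rw [← hedef]
        simp only [Algebra.smul_def, map_sub]
        ring
    have hd := SpansMod.chain_desc S₀ (fun u => x s - x u)
      (fun u => hsub _ _) (𝔞 := 𝔡) (N := ND) (F := famD x n (s + 1)) (fun u hu => by
        have hγ := mem_sup_span_self 𝔡 (x s - x u)
        refine hD _ (hminus _ (l3.trans le_sup_left) u (hS₀S u hu) hγ) (hsign _ W hWpos.ne' ?_)
        have h1 : w s • ((x s - x n) * ρ) ∈ 𝔡 ⊔ Ideal.span {x s - x u} := by
          refine smul_mem_ideal _ (Ideal.mul_mem_left _ _ ?_)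
          exact Ideal.mem_of_dvd _ (Finset.dvd_prod_of_mem _ hu) hγ
        convert sub_mem h1 (Ideal.mem_sup_left hK) using 1
        ring) final
    have hc := SpansMod.strip (𝔞 := 𝔠) (hadd s n) (hD (𝔠 ⊔ Ideal.span {x s + x n})
      (hplus _ (l2.trans le_sup_left) n hnS (mem_sup_span_self _ _)) (by
        refine hsign _ W hWpos.ne' ?_
        have h1 : w s • (ρ * (x s + x n)) ∈ 𝔠 ⊔ Ideal.span {x s + x n} :=
          smul_mem_ideal _ (Ideal.mul_mem_left _ _ (mem_sup_span_self _ _))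
        convert sub_mem (Ideal.mem_sup_left hG) h1 using 1
        ring)) hd (fun f hf => hf)
    have hb : SpansMod M (𝔟 ⊔ Ideal.span {x s - x n}) (NB + ND)
        {f | f ∈ famB x S₀ ∨ ∃ g ∈ famD x n (s + 1), f = (x s + x n) * g} := by
      have hγ := mem_sup_span_self 𝔟 (x s - x n)
      have hm := hminus _ (l1.trans le_sup_left) n hnS hγ
      refine SpansMod.strip (hadd s n) ?_ (hD _ ⟨hm.1.mono (le_colonBy _ _), ?_⟩ ?_)
        (fun f hf => hf)
      · have := hB (𝔟 ⊔ Ideal.span {x s - x n} ⊔ Ideal.span {x s + x n})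
          (hminus _ ((l1.trans le_sup_left).trans le_sup_left) n hnS (Ideal.mem_sup_left hγ)) n hnS ?_
        · rwa [hSn, Finset.erase_insert hnS₀] at this
        · refine mem_ideal_of_smul_mem (c := 2) (by norm_num) ?_
          convert sub_mem (mem_sup_span_self _ (x s + x n)) (Ideal.mem_sup_left hγ) using 1
          rw [two_smul]; ring
      · obtain ⟨_, w', hw', hp'⟩ := hm
        exact ⟨w', hw', fun m hm => le_colonBy _ _ (hp' m hm)⟩
      · rw [mem_colonBy]
        have h1 := Ideal.mul_mem_left _ e hγ
        have h2 : x s * e ∈ 𝔟 ⊔ Ideal.span {x s - x n} := Ideal.mem_sup_left (l1 he)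
        convert sub_mem (add_mem h2 h2) h1 using 1
        ring
    have hbc := SpansMod.strip (hsub s n) hb hc (fun f hf => hf)
    refine (SpansMod.chain S₀ (fun u => x s + x u) (fun u => hadd _ _) (N := ND + NB)
      (F := famD x n (s + 1)) (fun u hu => ?_) hbc).mono le_rfl ?_ ?_
    · have hγ := mem_sup_span_self 𝔞 (x s + x u)
      have hm := hplus _ le_sup_left u (hS₀S u hu) hγ
      refine SpansMod.strip heM (hD _ ⟨hm.1.mono le_sup_left, ?_⟩ (mem_sup_span_self _ _))
        (hB _ ⟨hm.1.mono (le_colonBy _ _), ?_⟩ u (hS₀S u hu) ?_) (fun f hf => Or.inl hf)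
      · obtain ⟨_, w', hw', hp'⟩ := hm
        exact ⟨w', hw', fun m hm => Ideal.mem_sup_left (hp' m hm)⟩
      · obtain ⟨_, w', hw', hp'⟩ := hm
        exact ⟨w', hw', fun m hm => le_colonBy _ _ (hp' m hm)⟩
      · rw [mem_colonBy]
        convert sub_mem (Ideal.mul_mem_left _ e hγ) (Ideal.mem_sup_left he) using 1
        ring
    · have h1 : ND = (k + 1) * NB := by rw [hND, hNB, Nat.factorial_succ]; ring
      have h2 : 2 ^ (k + 1) * (k + 1 + 1).factorial = (2 * k + 4) * ND := by
        rw [hND, Nat.factorial_succ (k + 1)]; ring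
      rw [h2, hcS₀]
      apply le_of_eq
      rw [h1]; ring
    · rintro _ ⟨h, H, rfl⟩
      have hbd := H.bounds s le_rfl hsn
      have hlast := H.last
      by_cases hbs : h n = 2 * n - s
      · rw [classD_of_last_eq hsn hbs]
        rcases lt_trichotomy (h s) n with ha | ha | ha
        · have ha' : h s = n - 1 := by
            by_cases h2 : s + 2 ≤ n
            · have := H.of_last_ge s le_rfl h2 hbs.ge; omega
            · omega
          right
          rw [prod_row_of_lt hsn hbd.1 ha]
          refine ⟨_, Or.inr ⟨_, Or.inl (prod_rows_mem_famD hsn H hbs), rfl⟩, ?_⟩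
          rw [Finset.filter_false_of_mem, Finset.prod_empty]
          · ring
          · intro l hl
            simp only [Finset.mem_Icc] at hl; omega
        · right
          rw [prod_row_of_le hsn ha.ge]
          refine ⟨_, Or.inl (Or.inl (prod_rows_mem_famB hsn H ha.ge)), ?_⟩
          rw [Finset.filter_true_of_mem]
          intro l hl
          simp only [Finset.mem_Icc] at hl; omega
        · left
          rw [prod_row_of_le hsn ha.le]
          refine ⟨2 * n - h s, ?_, _, prod_rows_mem_famD hsn H hbs, rfl⟩
          simp only [hS₀, Finset.mem_Icc]; omega
      · have hb' : h n ≤ 2 * n - (s + 1) := by omega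
        have hmem : classD x n (s + 1) h ∈ famD x n (s + 1) := ⟨h, H.succ hb', rfl⟩
        rw [classD_of_last_lt hsn hb']
        right
        rcases lt_or_ge (h s) n with ha | ha
        · rw [prod_row_of_lt hsn hbd.1 ha]
          refine ⟨_, Or.inr ⟨_, Or.inr ⟨(∏ l ∈ S₀ with h s < l, (x s - x l)) *
            classD x n (s + 1) h, ?_, rfl⟩, rfl⟩, by ring⟩
          rcases eq_or_lt_of_le hbd.1 with hs' | hs'
          · right
            refine ⟨_, hmem, ?_⟩
            rw [Finset.filter_true_of_mem]
            intro l hl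
            simp only [hS₀, Finset.mem_Icc] at hl; omega
          · left
            refine ⟨h s, ?_, _, hmem, rfl⟩
            rw [hS₀]
            exact Finset.mem_Icc.2 (by omega)
        · have ha' : h s = n := by
            by_contra hne
            by_cases h2 : s + 2 ≤ n
            · have := H.last_ge s le_rfl h2 (by omega); omega
            · omega
          rw [prod_row_of_le hsn ha]
          refine ⟨_, Or.inl (Or.inr ⟨_, hmem, rfl⟩), ?_⟩
          rw [Finset.filter_true_of_mem]
          intro l hl
          simp only [Finset.mem_Icc] at hl; omega

end SpanningD

section Deformation

variable {σ ι : Type*} [Fintype ι]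

lemma homogeneousComponent_mem_span {B : Set (MvPolynomial σ ℝ)}
    (hB : ∀ b ∈ B, ∃ e, b.IsHomogeneous e) (D : ℕ) {b : MvPolynomial σ ℝ}
    (hb : b ∈ Submodule.span ℝ B) : homogeneousComponent D b ∈ Submodule.span ℝ B := by
  induction hb using Submodule.span_induction with
  | mem b hb =>
    obtain ⟨e, he⟩ := hB b hb
    rw [homogeneousComponent_of_mem he]
    split_ifs
    · exact Submodule.subset_span hb
    · exact zero_mem _
  | zero => simp
  | add a b _ _ ha hb => rw [map_add]; exact add_mem ha hb
  | smul c a _ ha => rw [map_smul]; exact Submodule.smul_mem _ _ ha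

/-- Homogeneous polynomials spanning modulo homogeneous relations of positive degree still span
after the relations are perturbed by constants. -/
lemma exists_mem_span_sub_mem_of_perturb {g : ι → MvPolynomial σ ℝ} {d : ι → ℕ}
    (hg : ∀ i, (g i).IsHomogeneous (d i)) (hd : ∀ i, 0 < d i) (c : ι → ℝ)
    {B : Set (MvPolynomial σ ℝ)} (hB : ∀ b ∈ B, ∃ e, b.IsHomogeneous e)
    (H : ∀ r, ∃ b ∈ Submodule.span ℝ B, r - b ∈ Ideal.span (Set.range g))
    (r : MvPolynomial σ ℝ) : ∃ b ∈ Submodule.span ℝ B,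
      r - b ∈ Ideal.span (Set.range fun i => g i - C (c i)) := by
  set J := Ideal.span (Set.range fun i => g i - C (c i)) with hJ
  set V : Submodule ℝ (MvPolynomial σ ℝ) := Submodule.span ℝ B ⊔ J.restrictScalars ℝ with hV
  have key : ∀ D, ∀ r : MvPolynomial σ ℝ, r.IsHomogeneous D → r ∈ V := by
    intro D
    induction D using Nat.strong_induction_on with
    | _ D ih =>
      intro r hr
      obtain ⟨b, hb, hrb⟩ := H r
      obtain ⟨a, ha⟩ := Ideal.mem_span_range_iff_exists_fun.1 hrb
      have h1 : r = homogeneousComponent D b + ∑ i, homogeneousComponent D (a i * g i) := by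
        rw [← map_sum, ha, ← map_add, add_sub_cancel, homogeneousComponent_of_mem hr, if_pos rfl]
      rw [h1]
      refine add_mem (Submodule.mem_sup_left (homogeneousComponent_mem_span hB D hb))
        (sum_mem fun i _ => ?_)
      rw [← sum_homogeneousComponent (a i), Finset.sum_mul, map_sum]
      refine sum_mem fun e _ => ?_
      have he := homogeneousComponent_isHomogeneous e (a i)
      rw [homogeneousComponent_of_mem (he.mul (hg i))]
      split_ifs with hD
      · have h2 : homogeneousComponent e (a i) * g i = c i • homogeneousComponent e (a i)
            + homogeneousComponent e (a i) * (g i - C (c i)) := by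
          rw [MvPolynomial.smul_eq_C_mul]; ring
        rw [h2]
        refine add_mem (V.smul_mem _ (ih e (by have := hd i; omega) _ he))
          (Submodule.mem_sup_right ?_)
        exact J.mul_mem_left _ (Ideal.subset_span ⟨i, rfl⟩)
      · exact zero_mem _
  have hr : r ∈ V := by
    rw [← sum_homogeneousComponent r]
    exact sum_mem fun e _ => key e _ (homogeneousComponent_isHomogeneous e r)
  obtain ⟨b, hb, j, hj, rfl⟩ := Submodule.mem_sup.1 hr
  exact ⟨b, hb, by simpa using hj⟩

/-- Polynomials spanning the functions on a finite set of points are at least as many as the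
points. -/
lemma card_le_of_spans_eval {Q : Type*} [Fintype Q] {v : Q → σ → ℝ}
    (hv : Function.Injective v) {J : Ideal (MvPolynomial σ ℝ)}
    (hJ : ∀ q, ∀ f ∈ J, eval (v q) f = 0) {B : Finset (MvPolynomial σ ℝ)}
    (H : ∀ r, ∃ b ∈ Submodule.span ℝ (B : Set (MvPolynomial σ ℝ)), r - b ∈ J) :
    Fintype.card Q ≤ B.card := by
  let T : (Q → ℝ) →ₗ[ℝ] (B → ℝ) :=
    LinearMap.pi fun b => ∑ q, eval (v q) b.1 • LinearMap.proj q
  have hT : ∀ l b, T l b = ∑ q, eval (v q) b.1 * l q := by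
    intro l b; simp [T]
  have hinj : Function.Injective T := by
    rw [← LinearMap.ker_eq_bot, LinearMap.ker_eq_bot']
    intro l hl
    have h0 : ∀ b ∈ Submodule.span ℝ (B : Set (MvPolynomial σ ℝ)),
        ∑ q, eval (v q) b * l q = 0 := by
      intro b hb
      induction hb using Submodule.span_induction with
      | mem b hb => rw [← hT l ⟨b, hb⟩, hl]; rfl
      | zero => simp
      | add a b _ _ ha hb => simp [add_mul, Finset.sum_add_distrib, ha, hb]
      | smul c a _ ha => simp [mul_assoc, ← Finset.mul_sum, ha]
    have hli := linearIndependent_monoidHom (MvPolynomial σ ℝ) ℝ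
    have hinj' : Function.Injective fun q => ((eval (v q) : MvPolynomial σ ℝ →+* ℝ) :
        MvPolynomial σ ℝ →* ℝ) := by
      intro p q hpq
      apply hv
      funext k
      simpa using DFunLike.congr_fun hpq (X k)
    funext q
    refine Fintype.linearIndependent_iff.1 (hli.comp _ hinj') l ?_ q
    funext r
    obtain ⟨b, hb, hrb⟩ := H r
    simp only [Finset.sum_apply, Pi.smul_apply, Function.comp, smul_eq_mul, Pi.zero_apply]
    rw [← h0 b hb]
    refine Finset.sum_congr rfl fun q _ => ?_
    have := hJ q _ hrb
    rw [map_sub, sub_eq_zero] at this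
    simp [this, mul_comm]
  simpa using LinearMap.finrank_le_finrank_of_injective hinj

/-- A homogeneous spanning set of minimal cardinality modulo an ideal is independent. -/
lemma linearIndependent_of_spansMod {g : ι → MvPolynomial σ ℝ} {d : ι → ℕ}
    (hg : ∀ i, (g i).IsHomogeneous (d i)) (hd : ∀ i, 0 < d i)
    {Q : Type*} [Fintype Q] {v : Q → σ → ℝ} (hv : Function.Injective v) {c : ι → ℝ}
    (hc : ∀ i q, eval (v q) (g i) = c i)
    {B : Finset (MvPolynomial σ ℝ)} (hB : ∀ b ∈ B, ∃ e, b.IsHomogeneous e)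
    (hcard : B.card ≤ Fintype.card Q)
    (H : ∀ r, ∃ b ∈ Submodule.span ℝ (B : Set (MvPolynomial σ ℝ)),
      r - b ∈ Ideal.span (Set.range g)) :
    LinearIndependent ℝ (fun b : B => Ideal.Quotient.mk (Ideal.span (Set.range g)) b.1) := by
  classical
  have hmin : ∀ B' : Finset (MvPolynomial σ ℝ), (∀ b ∈ B', ∃ e, b.IsHomogeneous e) →
      (∀ r, ∃ b ∈ Submodule.span ℝ (B' : Set (MvPolynomial σ ℝ)),
        r - b ∈ Ideal.span (Set.range g)) → Fintype.card Q ≤ B'.card := by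
    intro B' hB' H'
    refine card_le_of_spans_eval hv ?_ (exists_mem_span_sub_mem_of_perturb hg hd c hB' H')
    intro q f hf
    have : Ideal.span (Set.range fun i => g i - C (c i)) ≤ RingHom.ker (eval (v q)) := by
      rw [Ideal.span_le]
      rintro _ ⟨i, rfl⟩
      simp [RingHom.mem_ker, hc]
    exact this hf
  rw [linearIndependent_iff_notMem_span]
  rintro ⟨b₀, hb₀⟩ hmem
  set I := Ideal.span (Set.range g)
  have h1 : ∃ b ∈ Submodule.span ℝ ((B.erase b₀ : Finset _) : Set (MvPolynomial σ ℝ)),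
      b₀ - b ∈ I := by
    have h2 : (fun b : B => Ideal.Quotient.mk I b.1) '' (Set.univ \ {⟨b₀, hb₀⟩})
        ⊆ (Ideal.Quotient.mkₐ ℝ I).toLinearMap '' ((B.erase b₀ : Finset _) : Set _) := by
      rintro _ ⟨⟨b, hb⟩, hne, rfl⟩
      refine ⟨b, ?_, rfl⟩
      simp only [Set.mem_sdiff, Set.mem_univ, Set.mem_singleton_iff, true_and,
        Subtype.mk.injEq] at hne
      simp [hb, hne]
    have h3 := Submodule.span_mono h2 hmem
    rw [← Submodule.map_span] at h3
    obtain ⟨b, hb, hbb⟩ := h3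
    refine ⟨b, hb, ?_⟩
    rw [← Ideal.Quotient.eq]
    exact hbb.symm
  obtain ⟨b₁, hb₁, hb₁I⟩ := h1
  have hspan : ∀ b ∈ Submodule.span ℝ (B : Set (MvPolynomial σ ℝ)),
      ∃ b' ∈ Submodule.span ℝ ((B.erase b₀ : Finset _) : Set (MvPolynomial σ ℝ)),
        b - b' ∈ I := by
    intro b hb
    induction hb using Submodule.span_induction with
    | mem b hb =>
      by_cases hbe : b = b₀
      · exact ⟨b₁, hb₁, hbe ▸ hb₁I⟩
      · exact ⟨b, Submodule.subset_span (by simpa [hbe] using hb), by simp⟩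
    | zero => exact ⟨0, zero_mem _, by simp⟩
    | add a b _ _ ha hb =>
      obtain ⟨a', ha', ha''⟩ := ha
      obtain ⟨b', hb', hb''⟩ := hb
      refine ⟨a' + b', add_mem ha' hb', ?_⟩
      convert add_mem ha'' hb'' using 1
      ring
    | smul t a _ ha =>
      obtain ⟨a', ha', ha''⟩ := ha
      refine ⟨t • a', Submodule.smul_mem _ _ ha', ?_⟩
      rw [← smul_sub]
      exact smul_mem_ideal t ha''
  have := hmin (B.erase b₀) (fun b hb => hB b (Finset.mem_of_mem_erase hb)) (fun r => by
    obtain ⟨b, hb, hrb⟩ := H r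
    obtain ⟨b', hb', hbb⟩ := hspan b hb
    refine ⟨b', hb', ?_⟩
    convert add_mem hrb hbb using 1
    ring)
  rw [Finset.card_erase_of_mem hb₀] at this
  have : 0 < B.card := Finset.card_pos.2 ⟨b₀, hb₀⟩
  omega

end Deformation

section Orbit

/-- A sign vector extended by one entry to an even one. -/
def evenSign {m : ℕ} (ε : Fin m → ℤˣ) : Fin (m + 1) → ℤˣ := Fin.cons (∏ k, ε k) ε

/-- The orbit of `(1, 2, …, m + 1)` under the Weyl group of type `D`. -/
def orbitPoint {m : ℕ} (q : Equiv.Perm (Fin (m + 1)) × (Fin m → ℤˣ)) (k : Fin (m + 1)) : ℝ :=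
  ((evenSign q.2 k : ℤ) : ℝ) * (q.1 k + 1 : ℕ)

lemma cast_units_sq (u : ℤˣ) : ((u : ℤ) : ℝ) ^ 2 = 1 := by
  rcases Int.units_eq_one_or u with rfl | rfl <;> simp

lemma orbitPoint_sq {m : ℕ} (q : Equiv.Perm (Fin (m + 1)) × (Fin m → ℤˣ)) (k : Fin (m + 1)) :
    orbitPoint q k ^ 2 = ((q.1 k + 1 : ℕ) : ℝ) ^ 2 := by
  rw [orbitPoint, mul_pow, cast_units_sq, one_mul]

lemma orbitPoint_injective {m : ℕ} : Function.Injective (orbitPoint (m := m)) := by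
  rintro ⟨σ, ε⟩ ⟨τ, δ⟩ h
  have hσ : σ = τ := by
    ext k
    have h1 := orbitPoint_sq (σ, ε) k
    rw [h, orbitPoint_sq, sq_eq_sq₀ (Nat.cast_nonneg _) (Nat.cast_nonneg _), Nat.cast_inj] at h1
    simp only at h1
    omega
  subst hσ
  congr 1
  funext k
  have h1 := congrFun h k.succ
  simp only [orbitPoint, evenSign, Fin.cons_succ] at h1
  have h2 := mul_right_cancel₀ (Nat.cast_ne_zero.2 (Nat.succ_ne_zero _)) h1
  exact Units.ext (by exact_mod_cast h2)

lemma prod_orbitPoint {m : ℕ} (q : Equiv.Perm (Fin (m + 1)) × (Fin m → ℤˣ)) :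
    ∏ k, orbitPoint q k = ∏ k : Fin (m + 1), ((k + 1 : ℕ) : ℝ) := by
  simp only [orbitPoint, Finset.prod_mul_distrib]
  rw [Equiv.prod_comp q.1 (fun k : Fin (m + 1) => ((k + 1 : ℕ) : ℝ))]
  have : ∏ k, evenSign q.2 k = 1 := by
    rw [Fin.prod_univ_succ]
    simp [evenSign, Int.units_mul_self]
  have h2 : ∏ k, ((evenSign q.2 k : ℤ) : ℝ) = 1 := by
    rw [← Int.cast_prod, ← Units.coe_prod, this]; simp
  rw [h2, one_mul]

lemma sum_orbitPoint_pow {m : ℕ} (q : Equiv.Perm (Fin (m + 1)) × (Fin m → ℤˣ)) (d : ℕ) :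
    ∑ k, orbitPoint q k ^ (2 * d) = ∑ k : Fin (m + 1), ((k + 1 : ℕ) : ℝ) ^ (2 * d) := by
  simp only [pow_mul, orbitPoint_sq]
  exact Equiv.sum_comp q.1 (fun k : Fin (m + 1) => (((k + 1 : ℕ) : ℝ) ^ 2) ^ d)

end Orbit

section Relations

variable {R : Type*} [CommRing R] {x : ℕ → R}

lemma prod_Icc_bot {i b : ℕ} (hib : i ≤ b) (f : ℕ → R) :
    ∏ l ∈ Finset.Icc i b, f l = f i * ∏ l ∈ Finset.Icc (i + 1) b, f l := by
  have : Finset.Icc i b = insert i (Finset.Icc (i + 1) b) := by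
    ext; simp only [Finset.mem_Icc, Finset.mem_insert]; omega
  rw [this, Finset.prod_insert (by simp)]

/-- The sum `∑_{k ≤ i} (x_k - x_{i+1}) ⋯ (x_k - x_b) Q_k`. -/
def tailSum (x : ℕ → R) (i b : ℕ) (Q : ℕ → R) : R :=
  ∑ k ∈ Finset.Icc 1 i, (∏ l ∈ Finset.Icc (i + 1) b, (x k - x l)) * Q k

lemma tailSum_zero (b : ℕ) (Q : ℕ → R) : tailSum x 0 b Q = 0 := by
  simp [tailSum]

lemma tailSum_add (i b : ℕ) (P Q : ℕ → R) :
    tailSum x i b (fun k => P k + Q k) = tailSum x i b P + tailSum x i b Q := by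
  simp only [tailSum, mul_add, Finset.sum_add_distrib]

lemma tailSum_mul_left (i b : ℕ) (c : R) (Q : ℕ → R) :
    tailSum x i b (fun k => c * Q k) = c * tailSum x i b Q := by
  simp only [tailSum, Finset.mul_sum]
  exact Finset.sum_congr rfl fun _ _ => by ring

lemma tailSum_succ_right {i b : ℕ} (hib : i ≤ b) (Q : ℕ → R) :
    tailSum x i (b + 1) Q = tailSum x i b (fun k => (x k - x (b + 1)) * Q k) := by
  simp only [tailSum, Finset.prod_Icc_succ_top (show i + 1 ≤ b + 1 by omega), mul_assoc]

lemma tailSum_succ_left {i b : ℕ} (hib : i + 1 ≤ b) (y : R) (Q : ℕ → R) :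
    tailSum x (i + 1) b (fun k => (x k + y) * Q k)
      = (x (i + 1) + y) * tailSum x (i + 1) b Q + tailSum x i b Q := by
  have h1 : tailSum x i b Q = ∑ k ∈ Finset.Icc 1 (i + 1),
      (x k - x (i + 1)) * ((∏ l ∈ Finset.Icc (i + 1 + 1) b, (x k - x l)) * Q k) := by
    rw [Finset.sum_Icc_succ_top (by omega), sub_self, zero_mul, add_zero]
    refine Finset.sum_congr rfl fun k _ => ?_
    rw [prod_Icc_bot hib]; ring
  rw [h1, tailSum, tailSum, Finset.mul_sum, ← Finset.sum_add_distrib]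
  exact Finset.sum_congr rfl fun _ _ => by ring

/-- The relations `f_{i,j}` with `j ≤ n - 2`. -/
def relLow (x : ℕ → R) (i j : ℕ) : R := tailSum x i j x

/-- The relations `f_{n,2n-1-r}`. -/
def relLast (x : ℕ → R) (n r : ℕ) : R :=
  (-1) ^ (n + r + 1) * tailSum x r n (fun _ => 1) + n * ∏ l ∈ Finset.Icc (r + 1) n, x l

/-- The relations `f_{i,n-1}`. -/
def relMid (x : ℕ → R) (n i : ℕ) : R :=
  tailSum x i (n - 1) (fun k => x k + x n) + (-1) ^ (n + i) * n * ∏ l ∈ Finset.Icc (i + 1) n, x l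

/-- The relations `f_{i,2n-m}` with `m ≤ n`. -/
def relHigh (x : ℕ → R) (n i m : ℕ) : R :=
  tailSum x i n (fun k => ∏ t ∈ Finset.Icc m n, (x k + x t)) +
    (-1) ^ (n + i + 1) * n * ((∏ l ∈ Finset.Ico (i + 1) m, x l) * ∏ t ∈ Finset.Icc m n, x t ^ 2)

lemma relLow_succ {i j : ℕ} (hij : i + 1 ≤ j) :
    relLow x (i + 1) (j + 1) = (x (i + 1) - x (j + 1)) * relLow x (i + 1) j + relLow x i j := by
  rw [relLow, tailSum_succ_right hij]
  simp only [sub_eq_add_neg]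
  exact tailSum_succ_left hij _ _

lemma relMid_eq {p i : ℕ} (hi : i ≤ p) :
    relMid x (p + 1) i = 2 * relLow x i p + (-1) ^ (p + 1 + i) * relLast x (p + 1) i := by
  have h2 : ((-1 : R) ^ (p + 1 + i)) * (-1) ^ (p + 1 + i) = 1 := by
    rw [← pow_add, Even.neg_one_pow ⟨_, rfl⟩]
  have h3 : tailSum x i p (fun k => x k + x (p + 1)) + tailSum x i (p + 1) (fun _ => 1)
      = 2 * relLow x i p := by
    rw [tailSum_succ_right hi, ← tailSum_add, relLow, ← tailSum_mul_left]
    congr 1; funext k; ring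
  rw [relMid, relLast, pow_succ _ (p + 1 + i), ← h3, Nat.add_sub_cancel]
  linear_combination tailSum x i (p + 1) (fun _ => 1) * h2

lemma relHigh_top {p i : ℕ} (hi : i + 1 ≤ p) :
    relHigh x (p + 1) (i + 1) (p + 1)
      = (x (i + 1) - x (p + 1)) * relMid x (p + 1) (i + 1) + relMid x (p + 1) i := by
  simp only [relHigh, relMid, Finset.Icc_self, Finset.prod_singleton, Nat.add_sub_cancel]
  rw [tailSum_succ_right hi]
  simp only [sub_eq_add_neg]
  rw [tailSum_succ_left hi, prod_Icc_bot (show i + 1 ≤ p + 1 by omega) x,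
    Finset.prod_Icc_succ_top (show i + 1 + 1 ≤ p + 1 by omega),
    show Finset.Ico (i + 1 + 1) (p + 1) = Finset.Icc (i + 1 + 1) p by
      ext; simp only [Finset.mem_Ico, Finset.mem_Icc]; omega]
  push_cast
  ring

lemma relHigh_succ {n i m : ℕ} (hi : i + 2 ≤ m) (hm : m < n) :
    relHigh x n (i + 1) m
      = (x (i + 1) + x m) * relHigh x n (i + 1) (m + 1) + relHigh x n i (m + 1) := by
  have h1 := tailSum_succ_left (x := x) (show i + 1 ≤ n by omega) (x m)
    (fun k => ∏ t ∈ Finset.Icc (m + 1) n, (x k + x t))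
  simp only [relHigh]
  simp only [prod_Icc_bot hm.le]
  rw [h1, Finset.prod_Ico_succ_top (show i + 1 + 1 ≤ m by omega),
    Finset.prod_eq_prod_Ico_succ_bot (show i + 1 < m + 1 by omega),
    Finset.prod_Ico_succ_top (show i + 1 + 1 ≤ m by omega)]
  ring

lemma relLast_succ {n r : ℕ} (hr : r + 1 < n) :
    (x (r + 1) + x n) * relLast x n (r + 1)
      = relLast x n r + (-1) ^ (n + r) * relHigh x n (r + 1) n := by
  have h2 : ((-1 : R) ^ (n + r)) * (-1) ^ (n + r) = 1 := by
    rw [← pow_add, Even.neg_one_pow ⟨_, rfl⟩]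
  have h1 := tailSum_succ_left (x := x) hr.le (x n) (fun _ => 1)
  simp only [mul_one] at h1
  have h3 : ∏ l ∈ Finset.Icc (r + 1 + 1) n, x l
      = (∏ l ∈ Finset.Ico (r + 1 + 1) n, x l) * x n := by
    rw [← Finset.prod_Ico_succ_top (by omega)]
    rfl
  simp only [relHigh, relLast, Finset.Icc_self, Finset.prod_singleton]
  rw [h1, prod_Icc_bot hr.le x, h3, show n + (r + 1) + 1 = n + r + 2 by ring]
  linear_combination (-(n : R) * (∏ l ∈ Finset.Ico (r + 1 + 1) n, x l) * x n ^ 2) * h2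

/-- The product of the roots labelled by a finite set of pairs. -/
def rootProd (x : ℕ → R) (n : ℕ) (C : Finset (Σ _ : ℕ, ℕ)) : R := ∏ c ∈ C, rootD x n c.1 c.2

lemma rootProd_mul_mem {𝔞 : Ideal R} {n i j : ℕ} {C : Finset (Σ _ : ℕ, ℕ)} {f g : R}
    (hC : ⟨i, j⟩ ∈ C) (hfg : rootD x n i j * f = g) (h : rootProd x n (C.erase ⟨i, j⟩) * g ∈ 𝔞) :
    rootProd x n C * f ∈ 𝔞 := by
  rw [rootProd, ← Finset.mul_prod_erase C _ hC]
  rw [← hfg] at h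
  convert h using 1
  rw [rootProd]; ring

variable {𝔞 : Ideal R} {p : ℕ}

lemma relHigh_zero_mem {n m : ℕ} (he : ∏ l ∈ Finset.Icc 1 n, x l ∈ 𝔞) (hm : 1 ≤ m)
    (hmn : m ≤ n) : relHigh x n 0 m ∈ 𝔞 := by
  rw [relHigh, tailSum_zero, zero_add, Finset.prod_pow, sq, ← mul_assoc (∏ l ∈ _, x l)]
  refine Ideal.mul_mem_left _ _ (Ideal.mul_mem_right _ _ ?_)
  convert he using 1
  rw [show Finset.Icc m n = Finset.Ico m (n + 1) from rfl, Finset.prod_Ico_consecutive _ hm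
    (by omega)]
  rfl

lemma relHigh_mem [Algebra ℝ R] {n i : ℕ} (hp : ∀ m ∈ Finset.Icc 1 (n - 1),
    psumW x (fun _ => 1) (Finset.Icc 1 n) m ∈ 𝔞) (hi : 1 ≤ i) (hin : i ≤ n) :
    relHigh x n i (i + 1) ∈ 𝔞 := by
  have hc : (Finset.Icc (i + 1) n).card = n - i := by rw [Nat.card_Icc]; omega
  have := sum_eval_sq_sub_mem hp
    (∏ l ∈ Finset.Icc (i + 1) n, (Polynomial.X - Polynomial.C (x l ^ 2)))
    ((natDegree_prod_X_sub_C_le _ _).trans (by omega))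
  convert this using 1
  have hsub : Finset.Icc 1 i ⊆ Finset.Icc 1 n := Finset.Icc_subset_Icc le_rfl hin
  rw [← Finset.sum_subset hsub]
  · have hs : (-1 : R) ^ (n - i) = (-1) ^ (n + i) := by
      rw [show n + i = (n - i) + (i + i) by omega, pow_add, Even.neg_one_pow (n := i + i) ⟨_, rfl⟩,
        mul_one]
    simp only [Polynomial.coeff_zero_eq_eval_zero, Polynomial.eval_prod, Polynomial.eval_sub,
      Polynomial.eval_X, Polynomial.eval_C, zero_sub, Finset.prod_neg, hc, hs, one_smul,
      Finset.sum_const, Nat.card_Icc, Nat.add_sub_cancel, relHigh, tailSum, Finset.Ico_self,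
      Finset.prod_empty, one_mul, ← Finset.prod_mul_distrib]
    rw [Algebra.smul_def, pow_succ, sub_eq_add_neg]
    congr 1
    · refine Finset.sum_congr rfl fun k _ => Finset.prod_congr rfl fun l _ => by ring
    · simp
      ring
  · intro k hk hk'
    simp only [Finset.mem_Icc] at hk hk'
    rw [Polynomial.eval_prod, Finset.prod_eq_zero (i := k), smul_zero]
    · simp only [Finset.mem_Icc]; omega
    · simp

lemma rootProd_mul_relHigh_mem [Algebra ℝ R] {n : ℕ} (he : ∏ l ∈ Finset.Icc 1 n, x l ∈ 𝔞)
    (hp : ∀ m ∈ Finset.Icc 1 (n - 1), psumW x (fun _ => 1) (Finset.Icc 1 n) m ∈ 𝔞) (i : ℕ) :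
    ∀ m, i + 1 ≤ m → m ≤ n → ∀ C : Finset (Σ _ : ℕ, ℕ),
      (∀ i' j', 1 ≤ i' → i' ≤ i → 2 * n - m < j' → j' ≤ 2 * n - 1 - i' → ⟨i', j'⟩ ∈ C) →
      rootProd x n C * relHigh x n i m ∈ 𝔞 := by
  induction i with
  | zero => exact fun m hm hmn C _ => 𝔞.mul_mem_left _ (relHigh_zero_mem he hm hmn)
  | succ i ih =>
    intro m hm
    induction m, hm using Nat.le_induction with
    | base => exact fun hmn C _ => 𝔞.mul_mem_left _ (relHigh_mem hp (by omega) (by omega))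
    | succ m hm ih' =>
      intro hmn C hC
      refine rootProd_mul_mem (i := i + 1) (j := 2 * n - m)
        (g := relHigh x n (i + 1) m - relHigh x n i (m + 1))
        (hC _ _ (by omega) le_rfl (by omega) (by omega)) ?_ ?_
      · rw [rootD, if_neg (by omega), if_neg (by omega), show 2 * n - (2 * n - m) = m by omega,
          relHigh_succ hm (by omega)]
        ring
      · rw [mul_sub]
        refine sub_mem (ih' (by omega) _ fun i' j' h1 h2 h3 h4 => ?_)
          (ih _ (by omega) hmn _ fun i' j' h1 h2 h3 h4 => ?_)
        all_goals
          refine Finset.mem_erase.2 ⟨?_, hC _ _ h1 (by omega) (by omega) h4⟩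
          intro h
          simp only [Sigma.mk.injEq, heq_eq_eq] at h
          omega

lemma rootProd_mul_relMid_mem [Algebra ℝ R] (he : ∏ l ∈ Finset.Icc 1 (p + 1), x l ∈ 𝔞)
    (hp : ∀ m ∈ Finset.Icc 1 p, psumW x (fun _ => 1) (Finset.Icc 1 (p + 1)) m ∈ 𝔞) (i : ℕ) :
    i ≤ p → ∀ C : Finset (Σ _ : ℕ, ℕ),
      (∀ i' j', 1 ≤ i' → i' ≤ i → p < j' → j' ≤ 2 * (p + 1) - 1 - i' → ⟨i', j'⟩ ∈ C) →
      rootProd x (p + 1) C * relMid x (p + 1) i ∈ 𝔞 := by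
  induction i with
  | zero =>
    intro _ C _
    rw [relMid, tailSum_zero, zero_add]
    exact 𝔞.mul_mem_left _ (𝔞.mul_mem_left _ he)
  | succ i ih =>
    intro hi C hC
    refine rootProd_mul_mem (i := i + 1) (j := p + 1)
      (g := relHigh x (p + 1) (i + 1) (p + 1) - relMid x (p + 1) i)
      (hC _ _ (by omega) le_rfl (by omega) (by omega)) ?_ ?_
    · rw [rootD, if_neg (by omega), if_pos (by omega), relHigh_top hi]
      ring
    · rw [mul_sub]
      refine sub_mem (rootProd_mul_relHigh_mem he hp _ _ (by omega) le_rfl _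
        fun i' j' h1 h2 h3 h4 => ?_) (ih (by omega) _ fun i' j' h1 h2 h3 h4 => ?_)
      all_goals
        refine Finset.mem_erase.2 ⟨?_, hC _ _ h1 (by omega) (by omega) h4⟩
        intro h
        simp only [Sigma.mk.injEq, heq_eq_eq] at h
        omega

lemma rootProd_mul_relLast_mem [Algebra ℝ R] {n : ℕ} (he : ∏ l ∈ Finset.Icc 1 n, x l ∈ 𝔞)
    (hp : ∀ m ∈ Finset.Icc 1 (n - 1), psumW x (fun _ => 1) (Finset.Icc 1 n) m ∈ 𝔞) (r : ℕ) :
    r < n → ∀ C : Finset (Σ _ : ℕ, ℕ),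
      (∀ i' j', 1 ≤ i' → i' ≤ r → n < j' → j' ≤ 2 * n - 1 - i' → ⟨i', j'⟩ ∈ C) →
      (∀ j', 2 * n - r ≤ j' → j' ≤ 2 * n - 1 → ⟨n, j'⟩ ∈ C) →
      rootProd x n C * relLast x n r ∈ 𝔞 := by
  induction r with
  | zero =>
    intro _ C _ _
    rw [relLast, tailSum_zero, mul_zero, zero_add]
    exact 𝔞.mul_mem_left _ (𝔞.mul_mem_left _ he)
  | succ r ih =>
    intro hr C hC hC'
    refine rootProd_mul_mem (i := n) (j := 2 * n - (r + 1))
      (hC' _ le_rfl (by omega)) (by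
        rw [rootD, if_pos rfl, show 2 * n - (2 * n - (r + 1)) = r + 1 by omega]) ?_
    rw [relLast_succ hr, mul_add, mul_left_comm]
    refine add_mem (ih (by omega) _ (fun i' j' h1 h2 h3 h4 => ?_) fun j' h1 h2 => ?_)
      (𝔞.mul_mem_left _ (rootProd_mul_relHigh_mem he hp _ _ (by omega) le_rfl _
        fun i' j' h1 h2 h3 h4 => ?_))
    · refine Finset.mem_erase.2 ⟨?_, hC _ _ h1 (by omega) h3 h4⟩
      intro h
      simp only [Sigma.mk.injEq, heq_eq_eq] at h
      omega
    · refine Finset.mem_erase.2 ⟨?_, hC' _ (by omega) h2⟩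
      intro h
      simp only [Sigma.mk.injEq, heq_eq_eq] at h
      omega
    · refine Finset.mem_erase.2 ⟨?_, hC _ _ h1 h2 (by omega) h4⟩
      intro h
      simp only [Sigma.mk.injEq, heq_eq_eq] at h
      omega

lemma rootProd_mul_relLow_mem [Algebra ℝ R] (he : ∏ l ∈ Finset.Icc 1 (p + 1), x l ∈ 𝔞)
    (hp : ∀ m ∈ Finset.Icc 1 p, psumW x (fun _ => 1) (Finset.Icc 1 (p + 1)) m ∈ 𝔞) (i : ℕ) :
    ∀ d j, j + d = p → i ≤ j → ∀ C : Finset (Σ _ : ℕ, ℕ),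
      (∀ i' j', 1 ≤ i' → i' ≤ i → j < j' → j' ≤ 2 * (p + 1) - 1 - i' → ⟨i', j'⟩ ∈ C) →
      (∀ j', 2 * (p + 1) - i ≤ j' → j' ≤ 2 * (p + 1) - 1 → ⟨p + 1, j'⟩ ∈ C) →
      rootProd x (p + 1) C * relLow x i j ∈ 𝔞 := by
  induction i with
  | zero =>
    intro d j _ _ C _ _
    rw [relLow, tailSum_zero, mul_zero]
    exact zero_mem _
  | succ i ih =>
    intro d
    induction d with
    | zero =>
      intro j hj hij C hC hC'
      obtain rfl : j = p := hj
      refine mem_ideal_of_smul_mem (c := 2) (by norm_num) ?_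
      have h1 := rootProd_mul_relMid_mem he hp (i + 1) hij C hC
      have h2 := rootProd_mul_relLast_mem he hp (i + 1) (by omega) C
        (fun i' j' h1 h2 h3 h4 => hC i' j' h1 h2 (by omega) h4) hC'
      convert sub_mem h1 (𝔞.mul_mem_left ((-1) ^ (j + 1 + (i + 1))) h2) using 1
      rw [relMid_eq hij, two_smul]
      ring
    | succ d ih' =>
      intro j hj hij C hC hC'
      refine rootProd_mul_mem (i := i + 1) (j := j + 1)
        (g := relLow x (i + 1) (j + 1) - relLow x i j)
        (hC _ _ (by omega) le_rfl (by omega) (by omega)) ?_ ?_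
      · rw [rootD, if_neg (by omega), if_pos (by omega), relLow_succ hij]
        ring
      · rw [mul_sub]
        refine sub_mem (ih' _ (by omega) (by omega) _ (fun i' j' h1 h2 h3 h4 => ?_)
          fun j' h1 h2 => ?_) (ih (d + 1) _ hj (by omega) _ (fun i' j' h1 h2 h3 h4 => ?_)
          fun j' h1 h2 => ?_)
        · refine Finset.mem_erase.2 ⟨?_, hC _ _ h1 (by omega) (by omega) h4⟩
          intro h
          simp only [Sigma.mk.injEq, heq_eq_eq] at h
          omega
        · refine Finset.mem_erase.2 ⟨?_, hC' _ (by omega) h2⟩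
          intro h
          simp only [Sigma.mk.injEq, heq_eq_eq] at h
          omega
        · refine Finset.mem_erase.2 ⟨?_, hC _ _ h1 (by omega) (by omega) h4⟩
          intro h
          simp only [Sigma.mk.injEq, heq_eq_eq] at h
          omega
        · refine Finset.mem_erase.2 ⟨?_, hC' _ (by omega) h2⟩
          intro h
          simp only [Sigma.mk.injEq, heq_eq_eq] at h
          omega

end Relations

section Complement

variable {R : Type*} [CommRing R]

/-- The largest column of the row `i` in the diagram of positive roots of type `D_n`. -/
def rowEnd (n i : ℕ) : ℕ := if i = n then 2 * n - 1 else 2 * n - 1 - i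

/-- The labels of the roots outside the lower ideal `h`. -/
def hessCompl (n : ℕ) (h : ℕ → ℕ) : Finset (Σ _ : ℕ, ℕ) :=
  (Finset.Icc 1 n).sigma fun i => Finset.Icc (h i + 1) (rowEnd n i)

lemma classD_eq_prod {n : ℕ} (hn : 1 ≤ n) (x : ℕ → R) (h : ℕ → ℕ) :
    classD x n 1 h
      = ∏ i ∈ Finset.Icc 1 n, ∏ j ∈ Finset.Icc (h i + 1) (rowEnd n i), rootD x n i j := by
  have : Finset.Icc 1 n = insert n (Finset.Ico 1 n) := by
    ext; simp only [Finset.mem_Icc, Finset.mem_Ico, Finset.mem_insert]; omega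
  rw [this, Finset.prod_insert (by simp), classD, mul_comm, rowEnd, if_pos rfl]
  congr 1
  refine Finset.prod_congr rfl fun i hi => ?_
  rw [rowEnd, if_neg (Finset.mem_Ico.1 hi).2.ne]

lemma classD_eq_rootProd {n : ℕ} (hn : 1 ≤ n) (x : ℕ → R) (h : ℕ → ℕ) :
    classD x n 1 h = rootProd x n (hessCompl n h) := by
  rw [classD_eq_prod hn, rootProd, hessCompl, Finset.prod_sigma]

lemma HessFrom.le_of_le {n : ℕ} {h : ℕ → ℕ} (H : HessFrom n 1 h) {i' i : ℕ} (hi' : 1 ≤ i')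
    (hi : i' ≤ i) : i < n → h i ≠ 2 * n - 1 - i → h i' ≤ h i := by
  induction i, hi using Nat.le_induction with
  | base => exact fun _ _ => le_rfl
  | succ i hi ih =>
    intro hn hne
    have h1 : h i ≠ 2 * n - 1 - i := fun hf => hne (H.full i (by omega) (by omega) hf)
    exact (ih (by omega) h1).trans (H.step i (by omega) (by omega) h1)

end Complement

lemma neg_one_pow_sub {i n : ℕ} (h : i ≤ n) :
    (-1 : MvPolynomial (Fin n) ℝ) ^ (n - i) = (-1) ^ (n + i) := by
  rw [show n + i = (n - i) + (i + i) by omega, pow_add, Even.neg_one_pow (n := i + i) ⟨_, rfl⟩,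
    mul_one]

lemma fDij_last {n j : ℕ} (hj : n ≤ j) :
    fDij n n j = relLast (xv n) n (2 * n - 1 - j) := by
  rw [fDij, if_pos rfl, relLast, tailSum, ← Finset.smul_sum, pow_succ _ (n + _),
    ← neg_one_pow_sub (by omega)]
  simp only [Algebra.smul_def, map_pow, map_neg, map_one, map_natCast, map_mul, mul_one, pow_succ]

lemma fDij_low {n i j : ℕ} (hi : i ≠ n) (hj : j ≤ n - 2) : fDij n i j = relLow (xv n) i j := by
  rw [fDij, if_neg hi, if_pos hj, relLow, tailSum]

lemma fDij_mid {n i : ℕ} (hn : 2 ≤ n) (hi : i < n) :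
    fDij n i (n - 1) = relMid (xv n) n i := by
  rw [fDij, if_neg hi.ne, if_neg (by omega), if_pos rfl, relMid, tailSum,
    ← neg_one_pow_sub hi.le]
  simp only [Algebra.smul_def, map_pow, map_neg, map_one, map_natCast, map_mul]

lemma fDij_high {n i j : ℕ} (hn : 2 ≤ n) (hi : i < n) (hj : n ≤ j) :
    fDij n i j = relHigh (xv n) n i (2 * n - j) := by
  rw [fDij, if_neg hi.ne, if_neg (by omega), if_neg (by omega), relHigh, tailSum,
    pow_succ _ (n + _), ← neg_one_pow_sub hi.le, show n - (j - n) = 2 * n - j by omega,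
    show Finset.Icc (i + 1) (n - 1 - (j - n)) = Finset.Ico (i + 1) (2 * n - j) by
      ext; simp only [Finset.mem_Icc, Finset.mem_Ico]; omega]
  simp only [Algebra.smul_def, map_pow, map_neg, map_one, map_natCast, map_mul, pow_succ]

/-- The product of the roots outside `h` maps the relations for `h` into the ideal of
invariants. -/
lemma classD_mul_fDij_mem {p : ℕ} (hp1 : 1 ≤ p) {h : ℕ → ℕ} (H : HessFrom (p + 1) 1 h)
    {𝔞 : Ideal (MvPolynomial (Fin (p + 1)) ℝ)}
    (he : ∏ l ∈ Finset.Icc 1 (p + 1), xv (p + 1) l ∈ 𝔞)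
    (hp : ∀ m ∈ Finset.Icc 1 p, psumW (xv (p + 1)) (fun _ => 1) (Finset.Icc 1 (p + 1)) m ∈ 𝔞)
    {i : ℕ} (hi : 1 ≤ i) (hin : i ≤ p + 1) :
    classD (xv (p + 1)) (p + 1) 1 h * fDij (p + 1) i (h i) ∈ 𝔞 := by
  rw [classD_eq_rootProd (by omega)]
  have hmem : ∀ i' j', 1 ≤ i' → i' < p + 1 → h i' < j' → j' ≤ 2 * (p + 1) - 1 - i' →
      (⟨i', j'⟩ : Σ _ : ℕ, ℕ) ∈ hessCompl (p + 1) h := by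
    intro i' j' h1 h2 h3 h4
    simp only [hessCompl, Finset.mem_sigma, Finset.mem_Icc, rowEnd, if_neg h2.ne]
    omega
  have hmem' : ∀ j', h (p + 1) < j' → j' ≤ 2 * (p + 1) - 1 →
      (⟨p + 1, j'⟩ : Σ _ : ℕ, ℕ) ∈ hessCompl (p + 1) h := by
    intro j' h3 h4
    simp only [hessCompl, Finset.mem_sigma, Finset.mem_Icc, rowEnd, if_true]
    omega
  have hlast := H.last
  rcases hin.eq_or_lt with rfl | hin
  · rw [fDij_last hlast.1]
    refine rootProd_mul_relLast_mem he hp _ (by omega) _ (fun i' j' h1 h2 h3 h4 => ?_)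
      fun j' h1 h2 => hmem' _ (by omega) h2
    refine hmem _ _ h1 (by omega) ?_ h4
    by_contra hcon
    have h5 := H.bounds i' h1 (by omega)
    have h6 := H.last_ge i' h1 (by omega) (by omega)
    omega
  have hb := H.bounds i hi hin
  by_cases hmax : h i = 2 * (p + 1) - 1 - i
  · rw [fDij_high (by omega) hin (by omega), hmax,
      show 2 * (p + 1) - (2 * (p + 1) - 1 - i) = i + 1 by omega]
    exact 𝔞.mul_mem_left _ (relHigh_mem hp hi hin.le)
  have hmono : ∀ i', 1 ≤ i' → i' ≤ i → h i' ≤ h i := fun i' h1 h2 => H.le_of_le h1 h2 hin hmax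
  rcases lt_trichotomy (h i) p with hlt | heq | hgt
  · rw [fDij_low hin.ne (by omega)]
    refine rootProd_mul_relLow_mem he hp i (p - h i) _ (by omega) hb.1 _
      (fun i' j' h1 h2 h3 h4 => hmem _ _ h1 (by omega) ((hmono i' h1 h2).trans_lt h3) h4)
      fun j' h1 h2 => hmem' _ ?_ h2
    by_contra hcon
    have := H.of_last_ge i hi (by omega) (by omega)
    omega
  · rw [heq, show fDij (p + 1) i p = fDij (p + 1) i (p + 1 - 1) from rfl,
      fDij_mid (by omega) hin]
    refine rootProd_mul_relMid_mem he hp i (by omega) _ (fun i' j' h1 h2 h3 h4 =>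
      hmem _ _ h1 (by omega) ((hmono i' h1 h2).trans_lt (by omega)) h4)
  · rw [fDij_high (by omega) hin (by omega)]
    refine rootProd_mul_relHigh_mem he hp i _ (by omega) (by omega) _ (fun i' j' h1 h2 h3 h4 =>
      hmem _ _ h1 (by omega) ((hmono i' h1 h2).trans_lt (by omega)) h4)

section Injectivity

lemma map_rootD {R S : Type*} [CommRing R] [CommRing S] (φ : R →+* S) (x : ℕ → R) (n i j : ℕ) :
    φ (rootD x n i j) = rootD (fun k => φ (x k)) n i j := by
  simp only [rootD]
  split_ifs <;> simp

lemma exists_rootD_eq_zero {n i j : ℕ} (hi : 1 ≤ i) (hin : i ≤ n)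
    (hj : i < j) (hj' : j ≤ rowEnd n i) :
    ∃ z : ℕ → ℤ, rootD z n i j = 0 ∧ ∀ i' j', 1 ≤ i' → i' ≤ n → i' < j' → j' ≤ rowEnd n i' →
      ¬(i' = i ∧ j' = j) → rootD z n i' j' ≠ 0 := by
  refine ⟨fun k => if k = i then (if i < n ∧ j ≤ n then (j : ℤ) else (j : ℤ) - 2 * n) else k,
    ?_, fun i' j' h1 h2 h3 h4 h5 => ?_⟩
  · simp only [rootD, rowEnd] at *
    split_ifs at * <;> omega
  · simp only [rootD, rowEnd] at *
    split_ifs at * <;> omega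

lemma HessFrom.lt_succ {n : ℕ} {h : ℕ → ℕ} (H : HessFrom n 1 h) {i : ℕ} (hi : 1 ≤ i)
    (hin : i ≤ n) : i ≤ h i ∧ h i ≤ rowEnd n i := by
  have := H.last
  rw [rowEnd]
  split_ifs with hi'
  · subst hi'; omega
  · exact H.bounds i hi (by omega)

lemma eval_xv {n k : ℕ} (z : ℕ → ℝ) (h1 : 1 ≤ k) (h2 : k ≤ n) :
    eval (fun l : Fin n => z (l + 1)) (xv n k) = z k := by
  rw [xv, dif_pos ⟨h1, h2⟩, eval_X]
  congr 1
  simp only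
  omega

lemma eval_rootD {n i j : ℕ} (z : ℕ → ℤ) (hi : 1 ≤ i) (hin : i ≤ n)
    (hj : i < j) (hj' : j ≤ rowEnd n i) :
    eval (fun l : Fin n => (z (l + 1) : ℝ)) (rootD (xv n) n i j) = (rootD z n i j : ℤ) := by
  have hx : ∀ k, 1 ≤ k → k ≤ n → eval (fun l : Fin n => (z (l + 1) : ℝ)) (xv n k) = z k :=
    fun k h1 h2 => eval_xv (fun k => (z k : ℝ)) h1 h2
  have hj'' : j ≤ 2 * n - 1 ∧ (i ≠ n → j ≤ 2 * n - 1 - i) := by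
    rw [rowEnd] at hj'
    split_ifs at hj' <;> omega
  rw [map_rootD, rootD, rootD]
  split_ifs
  · rw [hx _ (by omega) (by omega), hx _ (by omega) le_rfl]; simp
  · rw [hx _ (by omega) (by omega), hx _ (by omega) (by omega)]; simp
  · rw [hx _ (by omega) (by omega), hx _ (by omega) (by omega)]; simp

lemma HessFrom.le_of_classD_eq {n : ℕ} (hn : 1 ≤ n) {h h' : ℕ → ℕ} (H : HessFrom n 1 h)
    (H' : HessFrom n 1 h') (heq : classD (xv n) n 1 h = classD (xv n) n 1 h') {i : ℕ}
    (hi : 1 ≤ i) (hin : i ≤ n) : h' i ≤ h i := by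
  by_contra hlt
  push Not at hlt
  have b := H.lt_succ hi hin
  have b' := H'.lt_succ hi hin
  obtain ⟨z, hz, hz'⟩ := exists_rootD_eq_zero (j := h' i) hi hin (by omega) b'.2
  have h0 := congrArg (eval fun l : Fin n => (z (l + 1) : ℝ)) heq
  rw [classD_eq_rootProd hn, classD_eq_rootProd hn, rootProd, rootProd, map_prod, map_prod,
    Finset.prod_eq_zero (i := ⟨i, h' i⟩) (by
      simp only [hessCompl, Finset.mem_sigma, Finset.mem_Icc]; omega)
    (by rw [eval_rootD z hi hin (by omega) b'.2, hz, Int.cast_zero])] at h0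
  refine Finset.prod_ne_zero_iff.2 ?_ h0.symm
  rintro ⟨i', j'⟩ hc
  simp only [hessCompl, Finset.mem_sigma, Finset.mem_Icc] at hc
  have b'' := H'.lt_succ hc.1.1 hc.1.2
  rw [eval_rootD z hc.1.1 hc.1.2 (by omega) hc.2.2]
  refine Int.cast_ne_zero.2 (hz' _ _ hc.1.1 hc.1.2 (by omega) hc.2.2 ?_)
  rintro ⟨rfl, rfl⟩
  omega

end Injectivity

section Invariants

/-- Generators of the invariants of the Weyl group of type `D_{p+1}`. -/
def invD (p : ℕ) : Option (Fin p) → MvPolynomial (Fin (p + 1)) ℝ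
  | none => ∏ l ∈ Finset.Icc 1 (p + 1), xv (p + 1) l
  | some m => psumW (xv (p + 1)) (fun _ => 1) (Finset.Icc 1 (p + 1)) (m + 1)

/-- The degrees of the generators `invD`. -/
def degD (p : ℕ) : Option (Fin p) → ℕ
  | none => p + 1
  | some m => 2 * (m + 1)

lemma xv_isHomogeneous (n k : ℕ) : (xv n k).IsHomogeneous 1 := by
  rw [xv]
  split_ifs
  · exact isHomogeneous_X _ _
  · exact isHomogeneous_zero _ _ _

lemma invD_isHomogeneous (p : ℕ) (i : Option (Fin p)) : (invD p i).IsHomogeneous (degD p i) := by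
  cases i with
  | none =>
    have := IsHomogeneous.prod (Finset.Icc 1 (p + 1)) (fun l => xv (p + 1) l) (fun _ => 1)
      fun l _ => xv_isHomogeneous _ l
    simpa [degD, invD] using this
  | some m =>
    refine IsHomogeneous.sum _ _ _ fun k _ => ?_
    rw [one_smul]
    simpa [degD] using (xv_isHomogeneous (p + 1) k).pow (2 * (m + 1))

lemma degD_pos (p : ℕ) (i : Option (Fin p)) : 0 < degD p i := by
  cases i <;> simp [degD]

lemma prod_Icc_one {A : Type*} [CommMonoid A] (n : ℕ) (f : ℕ → A) :
    ∏ k ∈ Finset.Icc 1 n, f k = ∏ k : Fin n, f (k + 1) := by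
  rw [show Finset.Icc 1 n = Finset.Ico 1 (n + 1) from rfl, Finset.prod_Ico_eq_prod_range,
    Nat.add_sub_cancel, Finset.prod_range]
  simp only [add_comm]

lemma sum_Icc_one {A : Type*} [AddCommMonoid A] (n : ℕ) (f : ℕ → A) :
    ∑ k ∈ Finset.Icc 1 n, f k = ∑ k : Fin n, f (k + 1) :=
  prod_Icc_one (A := Multiplicative A) n f

lemma xv_succ {n : ℕ} (k : Fin n) : xv n (k + 1) = X k := by
  rw [xv, dif_pos ⟨by omega, by omega⟩]
  rfl

/-- The values of the invariants at the point `(1, 2, …, p + 1)`. -/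
def invVal (p : ℕ) : Option (Fin p) → ℝ
  | none => ∏ k : Fin (p + 1), ((k + 1 : ℕ) : ℝ)
  | some m => ∑ k : Fin (p + 1), ((k + 1 : ℕ) : ℝ) ^ (2 * ((m : ℕ) + 1))

lemma eval_invD (p : ℕ) (i : Option (Fin p))
    (q : Equiv.Perm (Fin (p + 1)) × (Fin p → ℤˣ)) :
    eval (orbitPoint q) (invD p i) = invVal p i := by
  cases i with
  | none =>
    rw [invD, prod_Icc_one]
    simp only [xv_succ, map_prod, eval_X]
    exact prod_orbitPoint q
  | some m =>
    rw [invD, psumW, sum_Icc_one]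
    simp only [xv_succ, map_sum, map_pow, eval_X, one_smul]
    exact sum_orbitPoint_pow q _

/-- The multiplicative monoid of homogeneous polynomials. -/
def homogeneousMonoid (n : ℕ) : Submonoid (MvPolynomial (Fin n) ℝ) where
  carrier := {f | ∃ d, f.IsHomogeneous d}
  one_mem' := ⟨0, isHomogeneous_one _ _⟩
  mul_mem' := by
    rintro a b ⟨d, hd⟩ ⟨e, he⟩
    exact ⟨_, hd.mul he⟩

lemma genMod_xv (n : ℕ) (𝔞 : Ideal (MvPolynomial (Fin n) ℝ)) :
    GenMod (xv n) 𝔞 (Finset.Icc 1 n) := by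
  intro S _ hS
  rw [eq_top_iff, ← MvPolynomial.adjoin_range_X, Algebra.adjoin_le_iff]
  rintro _ ⟨k, rfl⟩
  rw [← xv_succ]
  exact hS _ (Finset.mem_Icc.2 (by omega))

lemma prod_xv_mem_invD (p : ℕ) :
    ∏ l ∈ Finset.Icc 1 (p + 1), xv (p + 1) l ∈ Ideal.span (Set.range (invD p)) :=
  Ideal.subset_span ⟨none, rfl⟩

lemma psumW_xv_mem_invD {p m : ℕ} (hm : m ∈ Finset.Icc 1 p) :
    psumW (xv (p + 1)) (fun _ => 1) (Finset.Icc 1 (p + 1)) m ∈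
      Ideal.span (Set.range (invD p)) := by
  rw [Finset.mem_Icc] at hm
  refine Ideal.subset_span ⟨some ⟨m - 1, by omega⟩, ?_⟩
  rw [invD]
  congr 1
  simp only
  omega

/-- The classes of lower ideals extend to a basis of the coinvariant algebra. -/
lemma exists_linearIndependent_famD (p : ℕ) :
    ∃ B : Finset (MvPolynomial (Fin (p + 1)) ℝ), famD (xv (p + 1)) (p + 1) 1 ⊆ B ∧
      LinearIndependent ℝ
        (fun b : B => Ideal.Quotient.mk (Ideal.span (Set.range (invD p))) b.1) := by
  obtain ⟨B, hF, hM, hcard, hB⟩ := spansMod_famD (x := xv (p + 1))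
    (M := homogeneousMonoid (p + 1)) (fun k => ⟨1, xv_isHomogeneous _ k⟩)
    (fun k l => ⟨1, (xv_isHomogeneous _ k).add (xv_isHomogeneous _ l)⟩)
    (fun k l => ⟨1, (xv_isHomogeneous _ k).sub (xv_isHomogeneous _ l)⟩) (p + 1) p 1 (by omega)
    (fun _ => 1) (fun _ => one_pos) (Ideal.span (Set.range (invD p))) (genMod_xv _ _)
    (prod_xv_mem_invD p) (fun m hm => psumW_xv_mem_invD hm)
  refine ⟨B, hF, linearIndependent_of_spansMod (invD_isHomogeneous p) (degD_pos p)
    orbitPoint_injective (eval_invD p) hM (hcard.trans_eq ?_) hB⟩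
  simp [Fintype.card_perm, mul_comm]

end Invariants

lemma HessSubD.hessFrom {n : ℕ} {h : ℕ → ℕ} (h' : HessSubD n h) : HessFrom n 1 h'.1 := by
  obtain ⟨h', a1, a2, a3, a4, a5, a6, _, _⟩ := h'
  refine ⟨fun i h1 h2 => a1 i ?_, a2, fun i h1 h2 => a3 i ?_, fun i h1 h2 => a4 i ?_,
    fun i h1 h2 => a5 i ?_, fun i h1 h2 => a6 i ?_⟩
  all_goals
    rw [Finset.mem_Icc]
    omega

lemma HessSubD.classD_injective {n : ℕ} (hn : 1 ≤ n) {h : ℕ → ℕ} :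
    Function.Injective fun h' : HessSubD n h => classD (xv n) n 1 h'.1 := by
  intro a b hab
  refine Subtype.ext (funext fun i => ?_)
  by_cases hi : i ∈ Finset.Icc 1 n
  · have hi' := Finset.mem_Icc.1 hi
    exact le_antisymm (b.hessFrom.le_of_classD_eq hn a.hessFrom hab.symm hi'.1 hi'.2)
      (a.hessFrom.le_of_classD_eq hn b.hessFrom hab hi'.1 hi'.2)
  · rw [a.2.2.2.2.2.2.2.1 i hi, b.2.2.2.2.2.2.2.1 i hi]

lemma prod_alD_mul_classD {n : ℕ} (hn : 1 ≤ n) {h : ℕ → ℕ} (H : HessFrom n 1 h)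
    (h' : HessSubD n h) :
    (∏ i ∈ Finset.Icc 1 n, ∏ j ∈ Finset.Icc (h'.1 i + 1) (h i), alD n i j) * classD (xv n) n 1 h
      = classD (xv n) n 1 h'.1 := by
  rw [classD_eq_prod hn, classD_eq_prod hn, ← Finset.prod_mul_distrib]
  refine Finset.prod_congr rfl fun i hi => ?_
  have h1 := h'.2.2.2.2.2.2.2.2 i hi
  have h2 := (H.lt_succ (Finset.mem_Icc.1 hi).1 (Finset.mem_Icc.1 hi).2).2
  exact Finset.prod_Ico_consecutive (rootD (xv n) n i) (by omega) (by omega)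

/-- **Theorem 7.1 (type D).** For a Hessenberg function `h` of type `D_n` (`n ≥ 2`), the
classes `P_{h'} = ∏_{i=1}^{n} ∏_{j=h'(i)+1}^{h(i)} α_{i,j}` in
`R^{D}_h ≅ H^*(Hess(N,h))` — which are, up to nonzero scalars, the Poincaré duals
`[Hess(N,h')]` of the smaller regular nilpotent Hessenberg varieties — are linearly
independent over ℝ. -/
theorem stmt_18 (n : ℕ) (hn : 2 ≤ n) (h : ℕ → ℕ)
    (hh1 : ∀ i ∈ Finset.Icc 1 (n - 1), i ≤ h i ∧ h i ≤ 2 * n - 1 - i)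
    (hh2 : n ≤ h n ∧ h n ≤ 2 * n - 1)
    (hh3 : ∀ i ∈ Finset.Icc 1 (n - 2), h i ≠ 2 * n - 1 - i → h i ≤ h (i + 1))
    (hh4 : ∀ i ∈ Finset.Icc 1 (n - 2), h i = 2 * n - 1 - i → h (i + 1) = 2 * n - 1 - (i + 1))
    (hh5 : ∀ i ∈ Finset.Icc 1 (n - 2), n + 1 ≤ h i → 2 * n - i ≤ h n)
    (hh6 : ∀ i ∈ Finset.Icc 1 (n - 2), 2 * n - i ≤ h n → n - 1 ≤ h i) :
    LinearIndependent ℝ (fun h' : HessSubD n h =>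
      Ideal.Quotient.mk (IDh n h)
        (∏ i ∈ Finset.Icc 1 n, ∏ j ∈ Finset.Icc (h'.1 i + 1) (h i), alD n i j)) := by
  obtain ⟨p, rfl⟩ : ∃ p, n = p + 1 := ⟨n - 1, by omega⟩
  have H : HessFrom (p + 1) 1 h := by
    refine ⟨fun i h1 h2 => hh1 i ?_, hh2, fun i h1 h2 => hh3 i ?_, fun i h1 h2 => hh4 i ?_,
      fun i h1 h2 => hh5 i ?_, fun i h1 h2 => hh6 i ?_⟩
    all_goals
      rw [Finset.mem_Icc]
      omega
  set 𝔞 := Ideal.span (Set.range (invD p)) 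
  have hmul : ∀ f ∈ IDh (p + 1) h, f * classD (xv (p + 1)) (p + 1) 1 h ∈ 𝔞 := by
    have hle : IDh (p + 1) h ≤ colonBy 𝔞 (classD (xv (p + 1)) (p + 1) 1 h) := by
      rw [IDh, Ideal.span_le]
      rintro _ ⟨i, hi, rfl⟩
      exact mem_colonBy.2 (classD_mul_fDij_mem (by omega) H (prod_xv_mem_invD p)
        (fun m hm => psumW_xv_mem_invD hm) hi.1 hi.2)
    intro f hf
    rw [mul_comm]
    exact mem_colonBy.1 (hle hf)
  obtain ⟨B, hF, hB⟩ := exists_linearIndependent_famD p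
  have hind := hB.comp (fun h' : HessSubD (p + 1) h =>
    (⟨classD (xv (p + 1)) (p + 1) 1 h'.1, hF ⟨_, h'.hessFrom, rfl⟩⟩ : B))
    fun a b hab => HessSubD.classD_injective (by omega) (congrArg (fun b : B => b.1) hab)
  rw [linearIndependent_iff'] at hind ⊢
  intro s c hc
  refine hind s c ?_
  have hsmul : ∀ (I : Ideal (MvPolynomial (Fin (p + 1)) ℝ)) (t : ℝ) f,
      t • Ideal.Quotient.mk I f = Ideal.Quotient.mk I (t • f) := fun _ _ _ => rfl
  simp only [Function.comp, hsmul, ← map_sum, Ideal.Quotient.eq_zero_iff_mem] at hc ⊢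
  convert hmul _ hc using 1
  rw [Finset.sum_mul]
  refine Finset.sum_congr rfl fun h' _ => ?_
  rw [smul_mul_assoc, prod_alD_mul_classD (by omega) H]
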